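/- Let δ ∈ (0, 1/6) be fixed. For all X, T ≥ 1, one has 𝒩(X,T) ≪ (XT)^{2δ} · (X^{3/4} + X^{5/12}T + X^{1/4}T² + X^{−1/12}T³) + X^{5/6 − 5δ/6}, with implied constant depending only on δ. -/

import Mathlib

open WeierstrassCurve Filter

/-- The Weierstrass curve `y² = x³ + Ax + B` over `ℚ`. -/
def Ecurve (A B : ℤ) : WeierstrassCurve.Affine ℚ :=
  { a₁ := 0, a₂ := 0, a₃ := 0, a₄ := (A : ℚ), a₆ := (B : ℚ) }

/-- Membership in the family 𝓕 : the discriminant condition and minimality condition. -/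
def inFamily (A B : ℤ) : Prop :=
  4 * A ^ 3 + 27 * B ^ 2 ≠ 0 ∧
    ∀ p : ℕ, p.Prime → ¬((p : ℤ) ^ 4 ∣ A ∧ (p : ℤ) ^ 6 ∣ B)

/-- The height `H(E_{A,B}) = max {4|A|³, 27B²}`. -/
def Eheight (A B : ℤ) : ℤ := max (4 * |A| ^ 3) (27 * B ^ 2)

/-- The family 𝓕(X), identified with the set of parameters `(A, B)`. -/
def FX (X : ℝ) : Set (ℤ × ℤ) :=
  {p | inFamily p.1 p.2 ∧ (Eheight p.1 p.2 : ℝ) ≤ X}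

/-- The logarithmic Weil height of a rational number. -/
noncomputable def weilHeight (x : ℚ) : ℝ := Real.log (max |x.num| x.den)

/-- The height `h_x` on rational points of `E_{A,B}`. -/
noncomputable def hx {A B : ℤ} : (Ecurve A B).Point → ℝ
  | .zero => 0
  | @WeierstrassCurve.Affine.Point.some _ _ _ x _ _ => weilHeight x

/-- The canonical height `ĥ(P) = (1/2) lim_n 4⁻ⁿ h_x(2ⁿ P)`; since the limit exists, it is
formalized as a limsup. -/
noncomputable def canHeight {A B : ℤ} (P : (Ecurve A B).Point) : ℝ :=
  (1 / 2) * Filter.limsup (fun n : ℕ => hx ((2 ^ n : ℕ) • P) / 4 ^ n) Filter.atTop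

/-- `μ(E_{A,B})`, the minimal canonical height of a non-torsion rational point, valued in
`ℝ≥0∞` so that it is `∞` when there is no non-torsion point (i.e. when the rank is `0`). -/
noncomputable def muE (A B : ℤ) : ENNReal :=
  ⨅ P : {P : (Ecurve A B).Point // ¬IsOfFinAddOrder P}, ENNReal.ofReal (canHeight P.1)

/-- The family 𝓕_{≥1}(X) of curves of positive rank. -/
noncomputable def F1X (X : ℝ) : Set (ℤ × ℤ) :=
  {p ∈ FX X | 1 ≤ Module.rank ℤ (Ecurve p.1 p.2).Point}

/-- `𝒩(X, T)`: the number of curves `E_{A,B} ∈ 𝓕(X)` with `μ(E_{A,B}) ≤ log T`. -/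
noncomputable def Ncount (X T : ℝ) : ℕ :=
  Nat.card {p : ℤ × ℤ // p ∈ FX X ∧ muE p.1 p.2 ≤ ENNReal.ofReal (Real.log T)}

/-- The divisor bound `τ(n) ≪ n ^ ε`. -/
lemma exists_card_divisors_le_rpow {ε : ℝ} (hε : 0 < ε) :
    ∃ C : ℝ, 1 ≤ C ∧ ∀ n : ℕ, n ≠ 0 → (n.divisors.card : ℝ) ≤ C * (n : ℝ) ^ ε := by
  set c : ℝ := max 1 (1 / (ε * Real.log 2)) with hc
  have hlog : 0 < ε * Real.log 2 := mul_pos hε (Real.log_pos (by norm_num))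
  have hc1 : 1 ≤ c := le_max_left _ _
  have hc2 : 1 ≤ c * (ε * Real.log 2) := by
    have : 1 / (ε * Real.log 2) ≤ c := le_max_right _ _
    rwa [div_le_iff₀ hlog] at this
  obtain ⟨K, hK⟩ := exists_nat_gt ((2 : ℝ) ^ (1 / ε))
  refine ⟨c ^ K, one_le_pow₀ hc1, fun n hn => ?_⟩
  have hfac : (n : ℝ) ^ ε = ∏ p ∈ n.primeFactors, ((p : ℝ) ^ (n.factorization p)) ^ ε := by
    rw [Real.finsetProd_rpow _ _ (fun i _ => by positivity)]
    congr 1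
    conv_lhs => rw [← Nat.prod_factorization_pow_eq_self hn]
    rw [Finsupp.prod, Nat.support_factorization]
    push_cast
    rfl
  have hterm : ∀ p ∈ n.primeFactors, ((n.factorization p + 1 : ℕ) : ℝ) ≤
      (if p < K then c else 1) * ((p : ℝ) ^ (n.factorization p)) ^ ε := by
    intro p hp
    have hp2 : (2 : ℝ) ≤ p := by exact_mod_cast (Nat.prime_of_mem_primeFactors hp).two_le
    set e := n.factorization p
    have hpe : ((p : ℝ) ^ e) ^ ε = ((p : ℝ) ^ ε) ^ e := by
      rw [← Real.rpow_natCast, ← Real.rpow_mul (by positivity), mul_comm,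
        Real.rpow_mul (by positivity), Real.rpow_natCast]
    split_ifs with hpK
    · have h2 : (1 + e * (ε * Real.log 2)) ≤ ((p : ℝ) ^ e) ^ ε := by
        calc (1 + e * (ε * Real.log 2)) ≤ Real.exp (e * (ε * Real.log 2)) := by
              linarith [Real.add_one_le_exp (e * (ε * Real.log 2))]
          _ = ((2 : ℝ) ^ e) ^ ε := by
              rw [← Real.rpow_natCast, ← Real.rpow_mul (by positivity),
                Real.rpow_def_of_pos (by norm_num)]
              congr 1; ring
          _ ≤ _ := by gcongr
      calc ((e + 1 : ℕ) : ℝ) ≤ c * (1 + e * (ε * Real.log 2)) := by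
            push_cast
            nlinarith [Nat.cast_nonneg (α := ℝ) e]
        _ ≤ _ := by gcongr
    · have hp' : (2 : ℝ) ≤ (p : ℝ) ^ ε := by
        have : (2 : ℝ) ^ (1 / ε) ≤ p := hK.le.trans (by exact_mod_cast not_lt.mp hpK)
        calc (2 : ℝ) = ((2 : ℝ) ^ (1 / ε)) ^ ε := by
              rw [← Real.rpow_mul (by norm_num), one_div_mul_cancel hε.ne', Real.rpow_one]
          _ ≤ _ := by gcongr
      rw [one_mul, hpe]
      calc ((e + 1 : ℕ) : ℝ) ≤ (2 : ℝ) ^ e := by exact_mod_cast Nat.lt_two_pow_self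
        _ ≤ _ := by gcongr
  rw [Nat.card_divisors hn]
  push_cast
  calc ∏ p ∈ n.primeFactors, ((n.factorization p : ℝ) + 1)
      ≤ ∏ p ∈ n.primeFactors, ((if p < K then c else 1) *
          ((p : ℝ) ^ (n.factorization p)) ^ ε) :=
        Finset.prod_le_prod (fun _ _ => by positivity) (fun p hp => by exact_mod_cast hterm p hp)
    _ = (∏ p ∈ n.primeFactors, (if p < K then c else 1)) * (n : ℝ) ^ ε := by
        rw [Finset.prod_mul_distrib, hfac]
    _ ≤ c ^ K * (n : ℝ) ^ ε := by
        gcongr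
        rw [Finset.prod_ite, Finset.prod_const_one, mul_one, Finset.prod_const]
        refine pow_le_pow_right₀ hc1 ?_
        calc _ ≤ (Finset.range K).card := Finset.card_le_card (fun p hp => by
              simp at hp ⊢; exact hp.2)
          _ = K := Finset.card_range K

/-- Integers in an interval of length `L` that are pairwise congruent modulo `k`. -/
lemma card_le_of_pairwise_dvd_sub (S : Finset ℤ) {k : ℕ} (hk : 0 < k) {L : ℝ} (hL : 0 ≤ L)
    (hlen : ∀ x ∈ S, ∀ y ∈ S, ((x - y : ℤ) : ℝ) ≤ L)
    (hmod : ∀ x ∈ S, ∀ y ∈ S, (k : ℤ) ∣ x - y) : (S.card : ℝ) ≤ L / k + 1 := by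
  rcases S.eq_empty_or_nonempty with rfl | hne
  · simp; positivity
  have hk' : (0 : ℝ) < k := by exact_mod_cast hk
  set m := S.min' hne
  have hm : m ∈ S := S.min'_mem hne
  have hmin : ∀ x ∈ S, m ≤ x := fun x hx => S.min'_le x hx
  have hcard : S.card ≤ (Finset.range (⌊L / k⌋₊ + 1)).card := by
    refine Finset.card_le_card_of_injOn (fun x => ((x - m) / k).toNat) ?_ ?_
    · intro x hx
      obtain ⟨t, ht⟩ := hmod x hx m hm
      have hk0 : (k : ℤ) ≠ 0 := by exact_mod_cast hk.ne'
      have htn : 0 ≤ t := by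
        have := hmin x hx
        by_contra h
        push Not at h
        have : (k : ℤ) * t < 0 := mul_neg_of_pos_of_neg (by exact_mod_cast hk) h
        lia
      lift t to ℕ using htn
      simp only [Finset.coe_range, Set.mem_Iio, ht, Int.mul_ediv_cancel_left _ hk0, Int.toNat_natCast]
      rw [Nat.lt_succ_iff, Nat.le_floor_iff (by positivity), le_div_iff₀ hk']
      have := hlen x hx m hm
      rw [ht] at this
      push_cast at this
      linarith
    · intro x hx y hy hxy
      obtain ⟨t, ht⟩ := hmod x hx m hm
      obtain ⟨u, hu⟩ := hmod y hy m hm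
      have hk0 : (k : ℤ) ≠ 0 := by exact_mod_cast hk.ne'
      have hkp : (0 : ℤ) < k := by exact_mod_cast hk
      have h1 := hmin x hx
      have h2 := hmin y hy
      have ht0 : 0 ≤ t := by
        by_contra h
        have : (k : ℤ) * t < 0 := mul_neg_of_pos_of_neg hkp (by lia)
        lia
      have hu0 : 0 ≤ u := by
        by_contra h
        have : (k : ℤ) * u < 0 := mul_neg_of_pos_of_neg hkp (by lia)
        lia
      simp only [ht, hu, Int.mul_ediv_cancel_left _ hk0] at hxy
      have : t = u := by lia
      subst this
      lia
  rw [Finset.card_range] at hcard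
  calc (S.card : ℝ) ≤ (⌊L / k⌋₊ + 1 : ℕ) := by exact_mod_cast hcard
    _ ≤ L / k + 1 := by
      push_cast
      gcongr
      exact Nat.floor_le (by positivity)

/-- If `m = g * h` with `g = gcd m s` and `m ∣ s * t`, then `h ∣ t`. -/
lemma dvd_of_gcd_eq_of_dvd_mul {m g h : ℕ} {s t : ℤ} (hg : Int.gcd m s = g) (hm : m = g * h)
    (hg0 : 0 < g) (hdvd : (m : ℤ) ∣ s * t) : (h : ℤ) ∣ t := by
  have hb := Int.gcd_eq_gcd_ab (m : ℤ) s
  have h1 : (m : ℤ) ∣ g * t := by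
    rw [← hg, hb, add_mul, mul_assoc, show s * Int.gcdB m s * t = s * t * Int.gcdB m s by ring]
    exact dvd_add (dvd_mul_right _ _) (hdvd.mul_right _)
  rw [hm] at h1
  push_cast at h1
  have hgz : (g : ℤ) ≠ 0 := by exact_mod_cast hg0.ne'
  exact Int.dvd_of_mul_dvd_mul_left hgz h1

/-- Integers in an interval of length `L` whose squares are pairwise congruent modulo `m`. -/
lemma card_le_of_pairwise_dvd_sq_sub (S : Finset ℤ) {m : ℕ} (hm : 0 < m) {L C : ℝ} (hL : 0 ≤ L)
    (hC0 : 0 ≤ C)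
    (hlen : ∀ x ∈ S, ∀ y ∈ S, ((x - y : ℤ) : ℝ) ≤ L)
    (hmod : ∀ x ∈ S, ∀ y ∈ S, (m : ℤ) ∣ x ^ 2 - y ^ 2)
    (hC : ∀ c : ℕ, 0 < c → c ^ 2 ∣ m → ∀ x ∈ S, (c : ℤ) ∣ 2 * x → (c : ℝ) ≤ C) :
    (S.card : ℝ) ≤ m.divisors.card * (C * L / m + 1) := by
  classical
  rcases S.eq_empty_or_nonempty with rfl | ⟨x₀, hx₀⟩
  · simp only [Finset.card_empty, Nat.cast_zero]; positivity
  have hmap : ∀ x ∈ S, Int.gcd m (x - x₀) ∈ m.divisors := by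
    intro x _
    rw [Nat.mem_divisors]
    exact ⟨Int.natCast_dvd_natCast.mp (Int.gcd_dvd_left _ _), hm.ne'⟩
  rw [Finset.card_eq_sum_card_fiberwise hmap]
  push_cast
  rw [← nsmul_eq_mul]
  refine Finset.sum_le_card_nsmul _ _ _ (fun g hg => ?_)
  set R := S.filter (fun x => Int.gcd m (x - x₀) = g) with hR
  rcases R.eq_empty_or_nonempty with hRe | ⟨x₁, hx₁⟩
  · rw [hRe]; simp only [Finset.card_empty, Nat.cast_zero]; positivity
  obtain ⟨h, hgh⟩ := Nat.dvd_of_mem_divisors hg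
  have hgpos : 0 < g := Nat.pos_of_mem_divisors hg
  have hhpos : 0 < h := Nat.pos_of_ne_zero (by rintro rfl; simp at hgh; lia)
  have hgR : ∀ x ∈ R, (g : ℤ) ∣ x - x₀ := by
    intro x hx
    rw [hR, Finset.mem_filter] at hx
    rw [← hx.2]
    exact Int.gcd_dvd_right _ _
  have hhR : ∀ x ∈ R, (h : ℤ) ∣ x + x₀ := by
    intro x hx
    rw [hR, Finset.mem_filter] at hx
    have h1 := hmod x hx.1 x₀ hx₀
    refine dvd_of_gcd_eq_of_dvd_mul hx.2 hgh hgpos ?_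
    rwa [show (x - x₀) * (x + x₀) = x ^ 2 - x₀ ^ 2 by ring]
  have hlcm : ∀ x ∈ R, ∀ y ∈ R, ((Nat.lcm g h : ℕ) : ℤ) ∣ x - y := by
    intro x hx y hy
    have h1 : (g : ℤ) ∣ x - y := by
      have := dvd_sub (hgR x hx) (hgR y hy)
      rwa [sub_sub_sub_cancel_right] at this
    have h2 : (h : ℤ) ∣ x - y := by
      have := dvd_sub (hhR x hx) (hhR y hy)
      rwa [add_sub_add_right_eq_sub] at this
    have := Int.coe_lcm_dvd h1 h2
    rwa [Int.lcm_natCast_natCast] at this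
  have hcC : ((Nat.gcd g h : ℕ) : ℝ) ≤ C := by
    refine hC _ (Nat.gcd_pos_of_pos_left _ hgpos) ?_ x₀ hx₀ ?_
    · rw [hgh, sq]; exact mul_dvd_mul (Nat.gcd_dvd_left _ _) (Nat.gcd_dvd_right _ _)
    · have h1 : ((Nat.gcd g h : ℕ) : ℤ) ∣ x₁ - x₀ :=
        (Int.natCast_dvd_natCast.mpr (Nat.gcd_dvd_left g h)).trans (hgR x₁ hx₁)
      have h2 : ((Nat.gcd g h : ℕ) : ℤ) ∣ x₁ + x₀ :=
        (Int.natCast_dvd_natCast.mpr (Nat.gcd_dvd_right g h)).trans (hhR x₁ hx₁)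
      have := dvd_sub h2 h1
      rwa [show x₁ + x₀ - (x₁ - x₀) = 2 * x₀ by ring] at this
  have hlpos : 0 < Nat.lcm g h := Nat.lcm_pos hgpos hhpos
  refine (card_le_of_pairwise_dvd_sub R hlpos hL
    (fun x hx y hy => hlen x (Finset.mem_filter.mp hx).1 y (Finset.mem_filter.mp hy).1)
    hlcm).trans ?_
  have hml : (m : ℝ) = Nat.gcd g h * Nat.lcm g h := by
    rw [hgh]; exact_mod_cast (Nat.gcd_mul_lcm g h).symm
  have hl' : (0 : ℝ) < Nat.lcm g h := by exact_mod_cast hlpos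
  have hm' : (0 : ℝ) < m := by exact_mod_cast hm
  refine add_le_add_left ?_ _
  rw [div_le_div_iff₀ hl' hm', hml]
  have := mul_le_mul_of_nonneg_right hcC (mul_nonneg hL hl'.le)
  linarith
lemma exists_integral_coordinates {A B : ℤ} {x y : ℚ} (h : y ^ 2 = x ^ 3 + A * x + B) :
    ∃ b d : ℤ, 0 < d ∧ IsCoprime x.num d ∧ (x.den : ℤ) = d ^ 2 ∧ IsCoprime b d ∧
      (y ≠ 0 → b ≠ 0) ∧ b ^ 2 = x.num ^ 3 + A * x.num * d ^ 4 + B * d ^ 6 := by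
  set a := x.num
  set q : ℤ := (x.den : ℤ) with hq
  have hq0 : 0 < q := by rw [hq]; exact_mod_cast x.den_pos
  have hqQ : (q : ℚ) ≠ 0 := by exact_mod_cast hq0.ne'
  have hx : x = a / q := by rw [hq]; exact (Rat.num_div_den x).symm
  set f : ℤ := a ^ 3 + A * a * q ^ 2 + B * q ^ 3 with hf
  have hcop : IsCoprime a q := by
    rw [Int.isCoprime_iff_gcd_eq_one]; exact x.reduced
  have hfy : (f : ℚ) = q ^ 3 * y ^ 2 := by
    rw [h, hx, hf]; push_cast; field_simp
  have hsq : IsSquare ((q * f : ℤ) : ℚ) := by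
    refine ⟨q ^ 2 * y, ?_⟩
    push_cast; rw [hfy]; ring
  rw [Rat.isSquare_intCast_iff] at hsq
  obtain ⟨c, hc⟩ := hsq
  have hqf : IsCoprime q f := by
    have h1 : IsCoprime q (a ^ 3) := hcop.symm.pow_right
    have : f = a ^ 3 + q * (A * a * q + B * q ^ 2) := by rw [hf]; ring
    rw [this]
    exact h1.add_mul_left_right _
  obtain ⟨d₀, hd₀⟩ := Int.sq_of_isCoprime hqf (by rw [hc, sq])
  have hd : q = |d₀| ^ 2 := by
    rcases hd₀ with h | h
    · rw [h, sq_abs]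
    · nlinarith [sq_nonneg d₀]
  set d := |d₀|
  have hd0 : 0 < d := by
    rcases (abs_nonneg d₀).lt_or_eq with h | h
    · exact h
    · rw [show d = 0 from h.symm] at hd; simp at hd; lia
  have hdc : d ∣ c := by
    rw [← Int.pow_dvd_pow_iff two_ne_zero, sq c, ← hc, hd]
    exact dvd_mul_right _ _
  obtain ⟨b, hb⟩ := hdc
  have hfb : f = b ^ 2 := by
    have : d ^ 2 * f = d ^ 2 * b ^ 2 := by rw [← hd, hc, hb, hd]; ring
    exact mul_left_cancel₀ (by positivity) this
  refine ⟨b, d, hd0, ?_, hd, ?_, ?_, ?_⟩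
  · rw [hd] at hcop; exact (IsCoprime.pow_right_iff two_pos).mp hcop
  · rw [hd, hfb] at hqf
    exact ((IsCoprime.pow_iff two_pos two_pos).mp hqf).symm
  · rintro hy rfl
    rw [hfb] at hfy
    push_cast at hfy
    have : (q : ℚ) ^ 3 * y ^ 2 ≠ 0 := by positivity
    exact this (by rw [← hfy])
  · rw [← hfb, hf, hd]; ring

/-- A common divisor of numerator and denominator in the duplication formula is at most four
times a square dividing the discriminant. -/
lemma abs_le_of_dvd_duplication {A B a b d e : ℤ} {G : ℝ} (hd : IsCoprime a d)
    (hbd : IsCoprime b d) (hb : b ≠ 0)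
    (h : b ^ 2 = a ^ 3 + A * a * d ^ 4 + B * d ^ 6)
    (hG : ∀ g : ℕ, (g : ℤ) ^ 2 ∣ 4 * A ^ 3 + 27 * B ^ 2 → (g : ℝ) ≤ G)
    (h1 : e ∣ a ^ 4 - 2 * A * a ^ 2 * d ^ 4 - 8 * B * a * d ^ 6 + A ^ 2 * d ^ 8)
    (h2 : e ∣ 4 * d ^ 2 * b ^ 2) : |(e : ℝ)| ≤ 4 * G ^ 2 := by
  set s := 3 * a ^ 2 + A * d ^ 4 with hs
  have hed : IsCoprime e d := by
    have h3 : IsCoprime (a ^ 4) d := hd.pow_left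
    have h4 := h3.add_mul_left_left (-2 * A * a ^ 2 * d ^ 3 - 8 * B * a * d ^ 5 + A ^ 2 * d ^ 7)
    refine IsCoprime.of_isCoprime_of_dvd_left h4 (h1.trans (dvd_of_eq ?_))
    ring
  have h3 : e ∣ 4 * b ^ 2 := by
    refine (hed.pow_right (n := 2)).dvd_of_dvd_mul_left ?_
    rwa [show d ^ 2 * (4 * b ^ 2) = 4 * d ^ 2 * b ^ 2 by ring]
  have h4 : e ∣ 4 * s ^ 2 := by
    have h5 : a ^ 4 - 2 * A * a ^ 2 * d ^ 4 - 8 * B * a * d ^ 6 + A ^ 2 * d ^ 8 =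
        s ^ 2 - 8 * a * b ^ 2 := by rw [h, hs]; ring
    rw [h5] at h1
    have := dvd_add (h1.mul_left 4) (h3.mul_left (8 * a))
    refine this.trans (dvd_of_eq ?_)
    ring
  set g := Int.gcd s b with hg
  have hgpos : 0 < g := Int.gcd_pos_of_ne_zero_right _ hb
  obtain ⟨s', b', hsb, hs', hb'⟩ := Int.exists_gcd_one hgpos
  rw [← hg] at hs' hb'
  have h5 : e ∣ 4 * (g : ℤ) ^ 2 := by
    have hcop : IsCoprime (s' ^ 2) (b' ^ 2) :=
      IsCoprime.pow (Int.isCoprime_iff_gcd_eq_one.mpr hsb)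
    obtain ⟨u, v, huv⟩ := hcop
    have := dvd_add (h4.mul_left u) (h3.mul_left v)
    refine this.trans (dvd_of_eq ?_)
    rw [hs', hb']
    linear_combination (4 * (g : ℤ) ^ 2) * huv
  have h6 : (g : ℤ) ^ 2 ∣ 4 * A ^ 3 + 27 * B ^ 2 := by
    have hgd : IsCoprime (g : ℤ) d :=
      IsCoprime.of_isCoprime_of_dvd_left hbd ⟨b', by rw [mul_comm]; exact hb'⟩
    have : (g : ℤ) ^ 2 ∣ d ^ 12 * (4 * A ^ 3 + 27 * B ^ 2) := by
      have e1 : d ^ 12 * (4 * A ^ 3 + 27 * B ^ 2) = (3 * a ^ 2 + 4 * A * d ^ 4) * s ^ 2 -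
          27 * (a ^ 3 + A * a * d ^ 4 - B * d ^ 6) * b ^ 2 := by rw [h, hs]; ring
      rw [e1, hs', hb']
      exact ⟨(3 * a ^ 2 + 4 * A * d ^ 4) * s' ^ 2 -
        27 * (a ^ 3 + A * a * d ^ 4 - B * d ^ 6) * b' ^ 2, by ring⟩
    exact (IsCoprime.pow hgd).dvd_of_dvd_mul_left this
  have h7 := hG g h6
  have h8 : |e| ≤ 4 * (g : ℤ) ^ 2 := by
    have h0 : (0 : ℤ) < 4 * (g : ℤ) ^ 2 := by positivity
    exact Int.le_of_dvd h0 ((abs_dvd _ _).mpr h5)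
  calc |(e : ℝ)| ≤ 4 * (g : ℝ) ^ 2 := by exact_mod_cast h8
    _ ≤ 4 * G ^ 2 := by gcongr

/-- Archimedean lower bound for the duplication map in terms of the discriminant. -/
lemma disc_mul_pow_le_duplication {α β u v N M : ℝ} (hα : |α| ≤ 1) (hβ : |β| ≤ 1)
    (hN : N = max |u| |v|)
    (h1 : |u ^ 4 - 2 * α * u ^ 2 * v ^ 2 - 8 * β * u * v ^ 3 + α ^ 2 * v ^ 4| ≤ M)
    (h2 : |4 * v * (u ^ 3 + α * u * v ^ 2 + β * v ^ 3)| ≤ M) :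
    |4 * α ^ 3 + 27 * β ^ 2| * N ^ 4 ≤ 155 * M := by
  set F := u ^ 4 - 2 * α * u ^ 2 * v ^ 2 - 8 * β * u * v ^ 3 + α ^ 2 * v ^ 4
  set G := 4 * v * (u ^ 3 + α * u * v ^ 2 + β * v ^ 3)
  have hu : |u| ≤ N := hN ▸ le_max_left _ _
  have hv : |v| ≤ N := hN ▸ le_max_right _ _
  have hN0 : 0 ≤ N := (abs_nonneg u).trans hu
  have hM0 : 0 ≤ M := (abs_nonneg _).trans h1
  rcases hN0.eq_or_lt with hN0' | hNpos
  · rw [← hN0']; simp; positivity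
  have mono : ∀ c : ℝ, ∀ i j k l : ℕ, k + l = 3 →
      |c * α ^ i * β ^ j * u ^ k * v ^ l| ≤ |c| * N ^ 3 := by
    intro c i j k l hkl
    rw [abs_mul, abs_mul, abs_mul, abs_mul, abs_pow, abs_pow, abs_pow, abs_pow]
    calc |c| * |α| ^ i * |β| ^ j * |u| ^ k * |v| ^ l ≤ |c| * 1 ^ i * 1 ^ j * N ^ k * N ^ l := by
          gcongr
      _ = |c| * N ^ 3 := by rw [← hkl, pow_add]; ring
  have tri : ∀ x y X Y : ℝ, |x| ≤ X → |y| ≤ Y → |x + y| ≤ X + Y := fun x y X Y hx hy =>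
    (abs_add_le x y).trans (add_le_add hx hy)
  have concl : ∀ w f g C D : ℝ, |w| = N → |f| ≤ C * N ^ 3 → |g| ≤ D * N ^ 3 → C + D ≤ 620 →
      4 * (4 * α ^ 3 + 27 * β ^ 2) * w ^ 7 = f * F + g * G →
      |4 * α ^ 3 + 27 * β ^ 2| * N ^ 4 ≤ 155 * M := by
    intro w f g C D hw hf hg hCD h
    have h3 : |4 * (4 * α ^ 3 + 27 * β ^ 2) * w ^ 7| ≤ C * N ^ 3 * M + D * N ^ 3 * M := by
      rw [h]
      refine tri _ _ _ _ ?_ ?_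
      · rw [abs_mul]
        exact mul_le_mul hf h1 (abs_nonneg _) ((abs_nonneg _).trans hf)
      · rw [abs_mul]
        exact mul_le_mul hg h2 (abs_nonneg _) ((abs_nonneg _).trans hg)
    rw [abs_mul, abs_mul, abs_pow, hw, abs_of_pos (by norm_num : (0 : ℝ) < 4)] at h3
    have h4 : N ^ 3 * (|4 * α ^ 3 + 27 * β ^ 2| * N ^ 4) ≤ N ^ 3 * (155 * M) := by
      have : (C + D) * (N ^ 3 * M) ≤ 620 * (N ^ 3 * M) :=
        mul_le_mul_of_nonneg_right hCD (by positivity)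
      linarith
    exact le_of_mul_le_mul_left h4 (by positivity)
  rcases max_choice |u| |v| with hm | hm
  · refine concl u (16 * α ^ 3 * β ^ 0 * u ^ 3 * v ^ 0 + 108 * α ^ 0 * β ^ 2 * u ^ 3 * v ^ 0 +
      (-4) * α ^ 2 * β ^ 1 * u ^ 2 * v ^ 1 + 12 * α ^ 4 * β ^ 0 * u ^ 1 * v ^ 2 +
      88 * α ^ 1 * β ^ 2 * u ^ 1 * v ^ 2 + 12 * α ^ 3 * β ^ 1 * u ^ 0 * v ^ 3 +
      96 * α ^ 0 * β ^ 3 * u ^ 0 * v ^ 3)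
      (1 * α ^ 2 * β ^ 1 * u ^ 3 * v ^ 0 + 5 * α ^ 4 * β ^ 0 * u ^ 2 * v ^ 1 +
      32 * α ^ 1 * β ^ 2 * u ^ 2 * v ^ 1 + 26 * α ^ 3 * β ^ 1 * u ^ 1 * v ^ 2 +
      192 * α ^ 0 * β ^ 3 * u ^ 1 * v ^ 2 + (-3) * α ^ 5 * β ^ 0 * u ^ 0 * v ^ 3 +
      (-24) * α ^ 2 * β ^ 2 * u ^ 0 * v ^ 3) 336 283 (by rw [hN, hm]) ?_ ?_ (by norm_num)
      (by simp only [F, G]; ring)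
    · refine (tri _ _ _ _ (tri _ _ _ _ (tri _ _ _ _ (tri _ _ _ _ (tri _ _ _ _ (tri _ _ _ _
        (mono _ _ _ _ _ rfl) (mono _ _ _ _ _ rfl)) (mono _ _ _ _ _ rfl)) (mono _ _ _ _ _ rfl))
        (mono _ _ _ _ _ rfl)) (mono _ _ _ _ _ rfl)) (mono _ _ _ _ _ rfl)).trans (le_of_eq ?_)
      norm_num; ring
    · refine (tri _ _ _ _ (tri _ _ _ _ (tri _ _ _ _ (tri _ _ _ _ (tri _ _ _ _ (tri _ _ _ _
        (mono _ _ _ _ _ rfl) (mono _ _ _ _ _ rfl)) (mono _ _ _ _ _ rfl)) (mono _ _ _ _ _ rfl))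
        (mono _ _ _ _ _ rfl)) (mono _ _ _ _ _ rfl)) (mono _ _ _ _ _ rfl)).trans (le_of_eq ?_)
      norm_num; ring
  · refine concl v (12 * α ^ 0 * β ^ 0 * u ^ 2 * v ^ 1 + 16 * α ^ 1 * β ^ 0 * u ^ 0 * v ^ 3)
      ((-3) * α ^ 0 * β ^ 0 * u ^ 3 * v ^ 0 + 5 * α ^ 1 * β ^ 0 * u ^ 1 * v ^ 2 +
      27 * α ^ 0 * β ^ 1 * u ^ 0 * v ^ 3) 28 35 (by rw [hN, hm]) ?_ ?_ (by norm_num)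
      (by simp only [F, G]; ring)
    · refine (tri _ _ _ _ (mono _ _ _ _ _ rfl) (mono _ _ _ _ _ rfl)).trans (le_of_eq ?_)
      norm_num; ring
    · refine (tri _ _ _ _ (tri _ _ _ _ (mono _ _ _ _ _ rfl) (mono _ _ _ _ _ rfl))
        (mono _ _ _ _ _ rfl)).trans (le_of_eq ?_)
      norm_num; ring
/-- The height of `x` in which the denominator is weighted by `W`. -/
noncomputable def weightedHeight (W : ℝ) (x : ℚ) : ℝ := max |(x.num : ℝ)| (W * x.den)

lemma weightedHeight_pos {W : ℝ} (hW : 0 < W) (x : ℚ) : 0 < weightedHeight W x :=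
  lt_max_of_lt_right (mul_pos hW (by exact_mod_cast x.den_pos))

lemma one_le_max_num_den (x : ℚ) : 1 ≤ max |(x.num : ℝ)| (x.den : ℝ) :=
  le_max_of_le_right (by exact_mod_cast x.den_pos)

lemma log_weightedHeight_le {W : ℝ} (hW : 1 ≤ W) (x : ℚ) :
    Real.log (weightedHeight W x) ≤ weilHeight x + Real.log W := by
  have hW0 : 0 < W := by linarith
  have h1 := one_le_max_num_den x
  rw [weilHeight, ← Real.log_mul (by positivity) hW0.ne']
  refine Real.log_le_log (weightedHeight_pos hW0 x) (max_le ?_ ?_)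
  · have := le_max_left |(x.num : ℝ)| (x.den : ℝ)
    nlinarith [abs_nonneg (x.num : ℝ)]
  · have := le_max_right |(x.num : ℝ)| (x.den : ℝ)
    nlinarith

lemma Ecurve_equation {A B : ℤ} {x y : ℚ} (h : (Ecurve A B).Nonsingular x y) :
    y ^ 2 = x ^ 3 + A * x + B := by
  have := (WeierstrassCurve.Affine.equation_iff x y).mp h.1
  simpa [Ecurve] using this

lemma Ecurve_two_nsmul {A B : ℤ} {x y : ℚ} (h : (Ecurve A B).Nonsingular x y) (hy : y ≠ 0) :
    ∃ x' y' h', 2 • (Affine.Point.some x y h) = (Affine.Point.some x' y' h' :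
      (Ecurve A B).Point) ∧
      x' = (x ^ 4 - 2 * A * x ^ 2 - 8 * B * x + A ^ 2) / (4 * (x ^ 3 + A * x + B)) := by
  have hne : y ≠ (Ecurve A B).negY x y := by
    simp only [Affine.negY, Ecurve]
    intro h0
    apply hy
    linarith
  have hE := Ecurve_equation h
  rw [two_nsmul, Affine.Point.add_self_of_Y_ne hne]
  refine ⟨_, _, _, rfl, ?_⟩
  rw [Affine.slope_of_Y_ne rfl hne, ← hE]
  simp only [Affine.addX, Affine.negY, Ecurve]
  have : y - (-y - 0 * x - 0) = 2 * y := by ring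
  rw [this]
  field_simp
  have h4 : y ^ 4 = (y ^ 2) ^ 2 := by ring
  ring_nf
  rw [hE]
  ring

/-- Duplication formula in lowest terms. -/
lemma exists_duplication {A B : ℤ} {x y : ℚ} (h : (Ecurve A B).Nonsingular x y) (hy : y ≠ 0) :
    ∃ x' y' h', 2 • (Affine.Point.some x y h) = (Affine.Point.some x' y' h' :
      (Ecurve A B).Point) ∧ ∃ e : ℤ, e ≠ 0 ∧
      x.num ^ 4 - 2 * A * x.num ^ 2 * x.den ^ 2 - 8 * B * x.num * x.den ^ 3 + A ^ 2 * x.den ^ 4 =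
        e * x'.num ∧
      4 * x.den * (x.num ^ 3 + A * x.num * x.den ^ 2 + B * x.den ^ 3) = e * x'.den ∧
      ∀ G : ℝ, (∀ g : ℕ, (g : ℤ) ^ 2 ∣ 4 * A ^ 3 + 27 * B ^ 2 → (g : ℝ) ≤ G) →
        |(e : ℝ)| ≤ 4 * G ^ 2 := by
  obtain ⟨x', y', h', h2, hx'⟩ := Ecurve_two_nsmul h hy
  have hE := Ecurve_equation h
  obtain ⟨b, d, hd0, hcop, hden, hbd, hb, hbeq⟩ := exists_integral_coordinates hE
  refine ⟨x', y', h', h2, ?_⟩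
  have hden0 : (x.den : ℚ) ≠ 0 := by exact_mod_cast x.den_pos.ne'
  set F : ℤ := x.num ^ 4 - 2 * A * x.num ^ 2 * x.den ^ 2 - 8 * B * x.num * x.den ^ 3 +
    A ^ 2 * x.den ^ 4 with hF
  set G : ℤ := 4 * x.den * (x.num ^ 3 + A * x.num * x.den ^ 2 + B * x.den ^ 3) with hG
  have hGb : G = 4 * d ^ 2 * b ^ 2 := by rw [hG, hbeq, hden]; ring
  have hG0 : G ≠ 0 := by
    rw [hGb]
    have := hb hy
    positivity
  have hFG : x' = (F : ℚ) / G := by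
    have hGq : (G : ℚ) ≠ 0 := by exact_mod_cast hG0
    have h3 : (x ^ 3 + A * x + B : ℚ) ≠ 0 := by rw [← hE]; positivity
    have hx : (x.num : ℚ) = x * x.den := (Rat.mul_den_eq_num x).symm
    rw [hx', div_eq_div_iff (by positivity) hGq, hF, hG]
    push_cast
    rw [hx]
    ring
  obtain ⟨e, he1, he2⟩ := Rat.exists_eq_mul_div_num_and_eq_mul_div_den F hG0
  rw [← hFG] at he1 he2
  refine ⟨e, ?_, he1, he2, fun g hg => ?_⟩
  · rintro rfl
    simp at he2
    exact hG0 he2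
  · refine abs_le_of_dvd_duplication hcop hbd (hb hy) hbeq hg ?_ ?_
    · rw [show x.num ^ 4 - 2 * A * x.num ^ 2 * d ^ 4 - 8 * B * x.num * d ^ 6 + A ^ 2 * d ^ 8 = F by
        rw [hF, hden]; ring]
      exact ⟨_, he1⟩
    · rw [← hGb]; exact ⟨_, he2⟩
lemma ne_zero_of_not_isOfFinAddOrder {A B : ℤ} {x y : ℚ} {h : (Ecurve A B).Nonsingular x y}
    (hP : ¬IsOfFinAddOrder (Affine.Point.some x y h : (Ecurve A B).Point)) : y ≠ 0 := by
  rintro rfl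
  apply hP
  rw [isOfFinAddOrder_iff_nsmul_eq_zero]
  refine ⟨2, two_pos, ?_⟩
  rw [two_nsmul]
  exact Affine.Point.add_self_of_Y_eq (by simp [Affine.negY, Ecurve])

lemma not_isOfFinAddOrder_two_pow_nsmul {G : Type*} [AddMonoid G] {P : G}
    (hP : ¬IsOfFinAddOrder P) (n : ℕ) : ¬IsOfFinAddOrder ((2 ^ n : ℕ) • P) := by
  intro h
  obtain ⟨m, hm, hmP⟩ := isOfFinAddOrder_iff_nsmul_eq_zero.mp h
  exact hP (isOfFinAddOrder_iff_nsmul_eq_zero.mpr ⟨m * 2 ^ n, by positivity, by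
    rw [mul_nsmul', hmP]⟩)

/-- Upper bound for the height of a double, with a constant depending on the curve. -/
lemma exists_hx_two_nsmul_le (A B : ℤ) : ∃ C : ℝ, 0 ≤ C ∧ ∀ Q : (Ecurve A B).Point,
    ¬IsOfFinAddOrder Q → hx (2 • Q) ≤ 4 * hx Q + C := by
  set K : ℝ := 5 + 6 * |(A : ℝ)| + 12 * |(B : ℝ)| + |(A : ℝ)| ^ 2 with hK
  have hK1 : 1 ≤ K := by
    have := abs_nonneg (A : ℝ); have := abs_nonneg (B : ℝ)
    nlinarith
  refine ⟨Real.log K, Real.log_nonneg hK1, ?_⟩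
  rintro (_ | ⟨x, y, h⟩) hQ
  · exact absurd (IsOfFinAddOrder.zero : IsOfFinAddOrder (0 : (Ecurve A B).Point)) hQ
  obtain ⟨x', y', h', h2, e, he, hF, hG, -⟩ :=
    exists_duplication h (ne_zero_of_not_isOfFinAddOrder hQ)
  rw [h2]
  change weilHeight x' ≤ 4 * weilHeight x + Real.log K
  have hF' := congrArg (fun z : ℤ => (z : ℝ)) hF
  have hG' := congrArg (fun z : ℤ => (z : ℝ)) hG
  push_cast at hF' hG'
  have he1 : 1 ≤ |(e : ℝ)| := by exact_mod_cast Int.one_le_abs he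
  rw [weilHeight, weilHeight]
  set H := max |(x.num : ℝ)| (x.den : ℝ) with hH
  have hH1 : 1 ≤ H := one_le_max_num_den x
  have hu : |(x.num : ℝ)| ≤ H := le_max_left _ _
  have hv : |(x.den : ℝ)| ≤ H := by rw [Nat.abs_cast]; exact le_max_right _ _
  have mono : ∀ c : ℝ, ∀ k l : ℕ, k + l = 4 →
      |c * (x.num : ℝ) ^ k * (x.den : ℝ) ^ l| ≤ |c| * H ^ 4 := by
    intro c k l hkl
    rw [abs_mul, abs_mul, abs_pow, abs_pow]
    calc |c| * |(x.num : ℝ)| ^ k * |(x.den : ℝ)| ^ l ≤ |c| * H ^ k * H ^ l := by gcongr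
      _ = |c| * H ^ 4 := by rw [← hkl, pow_add]; ring
  have tri : ∀ x y X Y : ℝ, |x| ≤ X → |y| ≤ Y → |x + y| ≤ X + Y := fun x y X Y hx hy =>
    (abs_add_le x y).trans (add_le_add hx hy)
  have hA := abs_nonneg (A : ℝ)
  have hB := abs_nonneg (B : ℝ)
  have hH4 : 0 ≤ H ^ 4 := by positivity
  have b1 : |(e : ℝ) * x'.num| ≤ K * H ^ 4 := by
    rw [← hF']
    have := tri _ _ _ _ (tri _ _ _ _ (tri _ _ _ _ (mono 1 4 0 rfl) (mono (-2 * A) 2 2 rfl))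
      (mono (-8 * B) 1 3 rfl)) (mono (A ^ 2) 0 4 rfl)
    simp only [abs_mul, abs_neg, abs_pow] at this
    norm_num at this
    refine le_trans (le_of_eq ?_) (this.trans ?_)
    · congr 1
    · rw [hK, sq_abs]; nlinarith
  have b2 : |(e : ℝ) * x'.den| ≤ K * H ^ 4 := by
    rw [← hG']
    have := tri _ _ _ _ (tri _ _ _ _ (mono 4 3 1 rfl) (mono (4 * A) 1 3 rfl))
      (mono (4 * B) 0 4 rfl)
    simp only [abs_mul] at this
    norm_num at this
    refine le_trans (le_of_eq ?_) (this.trans ?_)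
    · congr 1; ring
    · rw [hK, sq_abs]; nlinarith [sq_nonneg (A : ℝ)]
  rw [abs_mul] at b1 b2
  have hpow : 4 * Real.log H = Real.log (H ^ 4) := by rw [Real.log_pow]; norm_num
  rw [hpow, add_comm, ← Real.log_mul (by positivity) (by positivity)]
  refine Real.log_le_log (by linarith [one_le_max_num_den x']) (max_le ?_ ?_)
  · nlinarith [abs_nonneg (x'.num : ℝ)]
  · have hden : (0 : ℝ) ≤ x'.den := Nat.cast_nonneg _
    rw [Nat.abs_cast] at b2
    nlinarith [hden]

/-- A point of small canonical height has bounded weighted naive height, provided that the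
duplication map loses at most a factor `K`. -/
lemma weightedHeight_le_of_canHeight_lt {A B : ℤ} {W K τ : ℝ} (hW : 1 ≤ W) (hK : 1 ≤ K)
    {x y : ℚ} {h : (Ecurve A B).Nonsingular x y}
    (hP : ¬IsOfFinAddOrder (Affine.Point.some x y h : (Ecurve A B).Point))
    (hdup : ∀ (x y x' y' : ℚ) (h : (Ecurve A B).Nonsingular x y)
      (h' : (Ecurve A B).Nonsingular x' y'), y ≠ 0 →
      2 • (Affine.Point.some x y h) = (Affine.Point.some x' y' h' : (Ecurve A B).Point) →
      weightedHeight W x ^ 4 ≤ K * weightedHeight W x')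
    (hτ : canHeight (Affine.Point.some x y h : (Ecurve A B).Point) < τ) :
    Real.log (weightedHeight W x) < 2 * τ + Real.log K / 3 := by
  set P : (Ecurve A B).Point := Affine.Point.some x y h with hPdef
  have hW0 : 0 < W := by linarith
  obtain ⟨C, hC0, hC⟩ := exists_hx_two_nsmul_le A B
  have hlogK : 0 ≤ Real.log K := Real.log_nonneg hK
  have hpt := fun n : ℕ => not_isOfFinAddOrder_two_pow_nsmul hP n
  have hsucc : ∀ n : ℕ, (2 ^ (n + 1) : ℕ) • P = 2 • ((2 ^ n : ℕ) • P) := by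
    intro n; rw [pow_succ, mul_nsmul]
  have hlow : ∀ n : ℕ, ∃ x' y' h', (2 ^ n : ℕ) • P = (Affine.Point.some x' y' h' :
      (Ecurve A B).Point) ∧ 4 ^ n * (Real.log (weightedHeight W x) - Real.log K / 3) ≤
        Real.log (weightedHeight W x') - Real.log K / 3 := by
    intro n
    induction n with
    | zero => exact ⟨x, y, h, by simp [hPdef], by simp⟩
    | succ n ih =>
      obtain ⟨x₁, y₁, h₁, e₁, hl₁⟩ := ih
      have hn := hpt n
      rw [e₁] at hn
      have hy₁ := ne_zero_of_not_isOfFinAddOrder hn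
      obtain ⟨x₂, y₂, h₂, e₂, -⟩ := Ecurve_two_nsmul h₁ hy₁
      refine ⟨x₂, y₂, h₂, by rw [hsucc, e₁, e₂], ?_⟩
      have h3 := hdup _ _ _ _ h₁ h₂ hy₁ e₂
      have h4 := Real.log_le_log (by have := weightedHeight_pos hW0 x₁; positivity) h3
      rw [Real.log_pow, Real.log_mul (by linarith) (weightedHeight_pos hW0 x₂).ne'] at h4
      push_cast at h4
      rw [pow_succ]
      nlinarith
  have hup : ∀ n : ℕ, hx ((2 ^ n : ℕ) • P) + C / 3 ≤ 4 ^ n * (hx P + C / 3) := by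
    intro n
    induction n with
    | zero => simp
    | succ n ih =>
      rw [hsucc, pow_succ]
      have := hC _ (hpt n)
      linarith
  have hlim : Tendsto (fun n : ℕ => Real.log (weightedHeight W x) - Real.log K / 3 -
      Real.log W * (1 / 4) ^ n) atTop
      (nhds (Real.log (weightedHeight W x) - Real.log K / 3 - Real.log W * 0)) :=
    tendsto_const_nhds.sub ((tendsto_pow_atTop_nhds_zero_of_lt_one (by norm_num)
      (by norm_num)).const_mul _)
  have hle : Real.log (weightedHeight W x) - Real.log K / 3 - Real.log W * 0 ≤
      limsup (fun n : ℕ => hx ((2 ^ n : ℕ) • P) / 4 ^ n) atTop := by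
    rw [← hlim.limsup_eq]
    refine limsup_le_limsup ?_ hlim.isCoboundedUnder_le ?_
    · refine Eventually.of_forall (fun n => ?_)
      obtain ⟨x', y', h', e, hl⟩ := hlow n
      have h4 : (0 : ℝ) < 4 ^ n := by positivity
      simp only
      rw [le_div_iff₀ h4, e]
      change _ ≤ weilHeight x'
      have h5 := log_weightedHeight_le hW x'
      have h6 : ((1 : ℝ) / 4) ^ n * 4 ^ n = 1 := by rw [← mul_pow]; norm_num
      have h7 : (Real.log (weightedHeight W x) - Real.log K / 3 - Real.log W * (1 / 4) ^ n) * 4 ^ n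
          = 4 ^ n * (Real.log (weightedHeight W x) - Real.log K / 3) - Real.log W := by
        rw [sub_mul, mul_assoc, h6]; ring
      rw [h7]
      linarith
    · refine isBoundedUnder_of ⟨hx P + C / 3, fun n => ?_⟩
      have h4 : (0 : ℝ) < 4 ^ n := by positivity
      rw [div_le_iff₀ h4]
      have := hup n
      linarith
  rw [canHeight] at hτ
  linarith

/-- The duplication map loses at most a factor controlled by the size of the discriminant and
its largest square divisor. -/
lemma weightedHeight_pow_le {A B : ℤ} {W G : ℝ} (hW : 0 < W) (hA : |(A : ℝ)| ≤ W ^ 2)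
    (hB : |(B : ℝ)| ≤ W ^ 3)
    (hG : ∀ g : ℕ, (g : ℤ) ^ 2 ∣ 4 * A ^ 3 + 27 * B ^ 2 → (g : ℝ) ≤ G)
    {x y x' y' : ℚ} (h : (Ecurve A B).Nonsingular x y) (h' : (Ecurve A B).Nonsingular x' y')
    (hy : y ≠ 0)
    (h2 : 2 • (Affine.Point.some x y h) = (Affine.Point.some x' y' h' : (Ecurve A B).Point)) :
    |(4 * A ^ 3 + 27 * B ^ 2 : ℝ)| * weightedHeight W x ^ 4 ≤
      620 * W ^ 6 * G ^ 2 * weightedHeight W x' := by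
  obtain ⟨x₁, y₁, h₁, h3, e, he, hF, hGe, hbd⟩ := exists_duplication h hy
  rw [h2] at h3
  obtain ⟨rfl, rfl⟩ : x' = x₁ ∧ y' = y₁ := by simpa using h3
  have he4 := hbd G hG
  have hF' := congrArg (fun z : ℤ => (z : ℝ)) hF
  have hG' := congrArg (fun z : ℤ => (z : ℝ)) hGe
  push_cast at hF' hG'
  have hN' := weightedHeight_pos hW x'
  have key := disc_mul_pow_le_duplication (α := A / W ^ 2) (β := B / W ^ 3) (u := x.num)
    (v := W * x.den) (N := weightedHeight W x) (M := |(e : ℝ)| * weightedHeight W x')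
    (by rw [abs_div, abs_of_pos (by positivity : 0 < W ^ 2)]; exact div_le_one_of_le₀ hA (by positivity))
    (by rw [abs_div, abs_of_pos (by positivity : 0 < W ^ 3)]; exact div_le_one_of_le₀ hB (by positivity))
    (by rw [weightedHeight, abs_mul, abs_of_pos hW, Nat.abs_cast]) ?_ ?_
  · have e1 : 4 * ((A : ℝ) / W ^ 2) ^ 3 + 27 * ((B : ℝ) / W ^ 3) ^ 2 =
        (4 * A ^ 3 + 27 * B ^ 2) / W ^ 6 := by field_simp
    rw [e1, abs_div, abs_of_pos (by positivity : 0 < W ^ 6), div_mul_eq_mul_div,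
      div_le_iff₀ (by positivity)] at key
    refine key.trans ?_
    calc 155 * (|(e : ℝ)| * weightedHeight W x') * W ^ 6
        ≤ 155 * (4 * G ^ 2 * weightedHeight W x') * W ^ 6 := by gcongr
      _ = _ := by ring
  · have : (x.num : ℝ) ^ 4 - 2 * (A / W ^ 2) * x.num ^ 2 * (W * x.den) ^ 2 -
        8 * (B / W ^ 3) * x.num * (W * x.den) ^ 3 + (A / W ^ 2) ^ 2 * (W * x.den) ^ 4 =
        e * x'.num := by
      rw [← hF']; field_simp
    rw [this, abs_mul]
    gcongr
    exact le_max_left _ _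
  · have : 4 * (W * (x.den : ℝ)) * (x.num ^ 3 + A / W ^ 2 * x.num * (W * x.den) ^ 2 +
        B / W ^ 3 * (W * x.den) ^ 3) = e * (W * x'.den) := by
      rw [show (e : ℝ) * (W * x'.den) = W * (e * x'.den) by ring, ← hG']; field_simp
    rw [this, abs_mul, abs_of_pos (by have := x'.den_pos; positivity : 0 < W * (x'.den : ℝ))]
    gcongr
    exact le_max_right _ _
/-- The pairs `(A, B)` for which `y² = x³ + Ax + B` has an integral point with prescribed
`x`-coordinate `a / d²`, in terms of lengths of intervals containing the possible values of the
remaining parameters. -/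
lemma card_curves_through_le (S : Finset (ℤ × ℤ)) {a : ℤ} {d : ℕ} (hd : 0 < d)
    (had : IsCoprime a d) {L M : ℝ} (hL : 0 ≤ L) (hM : 0 ≤ M)
    (hS : ∀ p ∈ S, ∃ b : ℤ, IsCoprime b d ∧ 0 ≤ b ∧
      b ^ 2 = a ^ 3 + p.1 * a * d ^ 4 + p.2 * d ^ 6)
    (hb : ∀ p ∈ S, ∀ q ∈ S, ∀ b c : ℤ, 0 ≤ b → 0 ≤ c →
      b ^ 2 = a ^ 3 + p.1 * a * d ^ 4 + p.2 * d ^ 6 →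
      c ^ 2 = a ^ 3 + q.1 * a * d ^ 4 + q.2 * d ^ 6 → ((b - c : ℤ) : ℝ) ≤ L)
    (hA : ∀ p ∈ S, ∀ q ∈ S, a * (p.1 - q.1) = d ^ 2 * (q.2 - p.2) →
      ((p.1 - q.1 : ℤ) : ℝ) ≤ M) :
    (S.card : ℝ) ≤ (d ^ 4).divisors.card * (2 * L / d ^ 4 + 1) * (M / d ^ 2 + 1) := by
  classical
  choose! b hbd hb0 hbeq using hS
  have hdz : (d : ℤ) ≠ 0 := by exact_mod_cast hd.ne'
  have h1 : ((S.image b).card : ℝ) ≤ (d ^ 4).divisors.card * (2 * L / d ^ 4 + 1) := by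
    have := card_le_of_pairwise_dvd_sq_sub (S.image b) (m := d ^ 4) (by positivity) hL
      (C := 2) (by norm_num) ?_ ?_ ?_
    · push_cast at this; exact this
    · simp only [Finset.forall_mem_image]
      intro p hp q hq
      exact hb p hp q hq _ _ (hb0 p hp) (hb0 q hq) (hbeq p hp) (hbeq q hq)
    · simp only [Finset.forall_mem_image]
      intro p hp q hq
      rw [hbeq p hp, hbeq q hq]
      push_cast
      exact ⟨(p.1 - q.1) * a + (p.2 - q.2) * d ^ 2, by ring⟩
    · intro c hc hcd
      simp only [Finset.forall_mem_image]
      intro p hp hcb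
      have h2 : c ∣ d ^ 2 := by
        rw [show d ^ 4 = (d ^ 2) ^ 2 by ring] at hcd
        exact (Nat.pow_dvd_pow_iff two_ne_zero).mp hcd
      have h3 : IsCoprime (c : ℤ) (b p) := by
        refine IsCoprime.of_isCoprime_of_dvd_left (y := (d : ℤ) ^ 2) ?_ (by exact_mod_cast h2)
        exact (hbd p hp).symm.pow_left
      have h4 : (c : ℤ) ∣ 2 := h3.dvd_of_dvd_mul_right hcb
      exact_mod_cast Int.le_of_dvd two_pos h4
  have h2 : ∀ β ∈ S.image b, (((S.filter (fun p => b p = β)).card : ℕ) : ℝ) ≤ M / d ^ 2 + 1 := by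
    intro β _
    have key : ∀ p ∈ S.filter (fun p => b p = β), ∀ q ∈ S.filter (fun p => b p = β),
        a * (p.1 - q.1) = d ^ 2 * (q.2 - p.2) := by
      intro p hp q hq
      rw [Finset.mem_filter] at hp hq
      have e1 := hbeq p hp.1
      have e2 := hbeq q hq.1
      rw [hp.2] at e1
      rw [hq.2] at e2
      have : (d : ℤ) ^ 4 * (a * (p.1 - q.1)) = d ^ 4 * (d ^ 2 * (q.2 - p.2)) := by linarith
      exact mul_left_cancel₀ (pow_ne_zero 4 hdz) this
    have hinj : Set.InjOn Prod.fst (S.filter (fun p => b p = β) : Set (ℤ × ℤ)) := by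
      intro p hp q hq hpq
      have := key p hp q hq
      rw [hpq, sub_self, mul_zero] at this
      have h0 := (mul_eq_zero.mp this.symm).resolve_left (pow_ne_zero 2 hdz)
      exact Prod.ext hpq (by lia)
    rw [← Finset.card_image_of_injOn hinj]
    have := card_le_of_pairwise_dvd_sub ((S.filter (fun p => b p = β)).image Prod.fst)
      (k := d ^ 2) (by positivity) hM ?_ ?_
    · push_cast at this; exact this
    · simp only [Finset.forall_mem_image]
      intro p hp q hq
      exact hA p (Finset.mem_filter.mp hp).1 q (Finset.mem_filter.mp hq).1 (key p hp q hq)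
    · simp only [Finset.forall_mem_image]
      intro p hp q hq
      have h3 : IsCoprime ((d : ℤ) ^ 2) a := had.symm.pow_left
      push_cast
      exact h3.dvd_of_dvd_mul_left ⟨_, key p hp q hq⟩
  have h3 : (S.card : ℝ) = ∑ β ∈ S.image b, ((S.filter (fun p => b p = β)).card : ℝ) := by
    exact_mod_cast Finset.card_eq_sum_card_image b S
  rw [h3]
  calc _ ≤ ∑ β ∈ S.image b, (M / (d : ℝ) ^ 2 + 1) := Finset.sum_le_sum h2
    _ = (S.image b).card * (M / (d : ℝ) ^ 2 + 1) := by rw [Finset.sum_const, nsmul_eq_mul]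
    _ ≤ _ := by gcongr

/-- Pairs `(A, B)` in the region where the point has small `x`-coordinate. -/
lemma card_curves_through_le_of_small (S : Finset (ℤ × ℤ)) {a : ℤ} {d : ℕ} (hd : 0 < d)
    (had : IsCoprime a d) {V : ℝ} (hV : 0 < V)
    (hSA : ∀ p ∈ S, |(p.1 : ℝ)| ≤ V ^ 4) (hSB : ∀ p ∈ S, |(p.2 : ℝ)| ≤ V ^ 6)
    (hS : ∀ p ∈ S, ∃ b : ℤ, IsCoprime b d ∧ 0 ≤ b ∧
      b ^ 2 = a ^ 3 + p.1 * a * d ^ 4 + p.2 * d ^ 6)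
    (ha : |(a : ℝ)| ≤ 2 * V ^ 2 * d ^ 2) :
    (S.card : ℝ) ≤ (d ^ 4).divisors.card * (8 * V ^ 3 / d + 1) * (2 * V ^ 4 / d ^ 2 + 1) := by
  have hd' : (0 : ℝ) < d := by exact_mod_cast hd
  have := card_curves_through_le S hd had (L := 4 * V ^ 3 * d ^ 3) (M := 2 * V ^ 4) (by positivity)
    (by positivity) hS ?_ ?_
  · rwa [show 2 * (4 * V ^ 3 * (d : ℝ) ^ 3) / d ^ 4 = 8 * V ^ 3 / d by field_simp; ring] at this
  · intro p hp q hq b c hb hc hbe hce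
    have hbe' := congrArg (fun z : ℤ => (z : ℝ)) hbe
    push_cast at hbe' ⊢
    have hc' : (0 : ℝ) ≤ c := by exact_mod_cast hc
    have h1 : (b : ℝ) ^ 2 ≤ (4 * V ^ 3 * d ^ 3) ^ 2 := by
      rw [hbe']
      have i1 : (a : ℝ) ^ 3 ≤ (2 * V ^ 2 * d ^ 2) ^ 3 :=
        (le_abs_self _).trans (by rw [abs_pow]; gcongr)
      have i2 : (p.1 : ℝ) * a * d ^ 4 ≤ V ^ 4 * (2 * V ^ 2 * d ^ 2) * d ^ 4 := by
        refine (le_abs_self _).trans ?_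
        rw [abs_mul, abs_mul, abs_of_nonneg (by positivity : (0 : ℝ) ≤ (d : ℝ) ^ 4)]
        gcongr
        exact hSA p hp
      have i3 : (p.2 : ℝ) * d ^ 6 ≤ V ^ 6 * d ^ 6 := by
        gcongr
        exact (le_abs_self _).trans (hSB p hp)
      have : 0 ≤ V ^ 6 * (d : ℝ) ^ 6 := by positivity
      nlinarith
    have := abs_le_of_sq_le_sq' h1 (by positivity)
    linarith [this.2]
  · intro p hp q hq _
    push_cast
    have := abs_le.mp (hSA p hp)
    have := abs_le.mp (hSA q hq)
    linarith

/-- Pairs `(A, B)` in the region where the point has large `x`-coordinate. -/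
lemma card_curves_through_le_of_large (S : Finset (ℤ × ℤ)) {a : ℤ} {d : ℕ} (hd : 0 < d)
    (had : IsCoprime a d) {V m : ℝ} (hV : 0 < V) (hm : 0 < m)
    (hSA : ∀ p ∈ S, |(p.1 : ℝ)| ≤ V ^ 4) (hSB : ∀ p ∈ S, |(p.2 : ℝ)| ≤ V ^ 6)
    (hS : ∀ p ∈ S, ∃ b : ℤ, IsCoprime b d ∧ 0 ≤ b ∧
      b ^ 2 = a ^ 3 + p.1 * a * d ^ 4 + p.2 * d ^ 6)
    (ha : 2 * V ^ 2 * d ^ 2 < (a : ℝ)) (ham : (a : ℝ) ≤ m ^ 2) :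
    (S.card : ℝ) ≤ (d ^ 4).divisors.card *
      ((12 * V ^ 9 / d + 6 * V ^ 4 * m + 2 * V ^ 6 + m ^ 2) / a) := by
  have hd' : (0 : ℝ) < d := by exact_mod_cast hd
  have ha0 : (0 : ℝ) < a := lt_trans (by positivity) ha
  set s := Real.sqrt a with hs
  have hs0 : 0 < s := Real.sqrt_pos.mpr ha0
  have hss : s ^ 2 = a := Real.sq_sqrt ha0.le
  have hVs : V * d ≤ s := by
    refine Real.le_sqrt_of_sq_le ?_
    have : 0 < V ^ 2 * (d : ℝ) ^ 2 := by positivity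
    nlinarith
  have hsm : s ≤ m := by
    rw [hs]; exact Real.sqrt_le_iff.mpr ⟨hm.le, ham⟩
  have hclose : ∀ p ∈ S, ∀ b : ℤ, 0 ≤ b → b ^ 2 = a ^ 3 + p.1 * a * d ^ 4 + p.2 * d ^ 6 →
      |(b : ℝ) ^ 2 - a ^ 3| ≤ 3 / 2 * (V ^ 4 * a * d ^ 4) := by
    intro p hp b hb hbe
    have hbe' := congrArg (fun z : ℤ => (z : ℝ)) hbe
    push_cast at hbe'
    rw [show (b : ℝ) ^ 2 - a ^ 3 = p.1 * a * d ^ 4 + p.2 * d ^ 6 by linarith]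
    have i1 : |(p.1 : ℝ) * a * d ^ 4| ≤ V ^ 4 * a * d ^ 4 := by
      rw [abs_mul, abs_mul, abs_of_nonneg (by positivity : (0 : ℝ) ≤ (d : ℝ) ^ 4),
        abs_of_pos ha0]
      gcongr
      exact hSA p hp
    have i2 : |(p.2 : ℝ) * d ^ 6| ≤ V ^ 6 * d ^ 6 := by
      rw [abs_mul, abs_of_nonneg (by positivity : (0 : ℝ) ≤ (d : ℝ) ^ 6)]
      gcongr
      exact hSB p hp
    have i3 : V ^ 6 * (d : ℝ) ^ 6 ≤ 1 / 2 * (V ^ 4 * a * d ^ 4) := by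
      have : 0 < V ^ 4 * (d : ℝ) ^ 4 := by positivity
      nlinarith
    linarith [abs_add_le ((p.1 : ℝ) * a * d ^ 4) (p.2 * d ^ 6)]
  have hlow : ∀ p ∈ S, ∀ b : ℤ, 0 ≤ b → b ^ 2 = a ^ 3 + p.1 * a * d ^ 4 + p.2 * d ^ 6 →
      s ^ 3 / 2 ≤ b := by
    intro p hp b hb hbe
    have h1 := (abs_le.mp (hclose p hp b hb hbe)).1
    have h2 : V ^ 4 * a * d ^ 4 ≤ 1 / 4 * (a : ℝ) ^ 3 := by
      have h3 : (2 * V ^ 2 * (d : ℝ) ^ 2) ^ 2 ≤ (a : ℝ) ^ 2 := by gcongr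
      nlinarith
    have hb' : (0 : ℝ) ≤ b := by exact_mod_cast hb
    refine (sq_le_sq₀ (by positivity) hb').mp ?_
    have : (s ^ 3 / 2) ^ 2 = (a : ℝ) ^ 3 / 4 := by rw [← hss]; ring
    rw [this]
    have : 0 < (a : ℝ) ^ 3 := by positivity
    linarith
  have := card_curves_through_le S hd had (L := 3 * V ^ 4 * d ^ 4 / s)
    (M := 2 * V ^ 6 * d ^ 2 / a) (by positivity) (by positivity) hS ?_ ?_
  · refine this.trans ?_
    rw [mul_assoc]
    refine mul_le_mul_of_nonneg_left ?_ (by positivity)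
    have e1 : 2 * (3 * V ^ 4 * (d : ℝ) ^ 4 / s) / d ^ 4 = 6 * V ^ 4 / s := by field_simp; ring
    have e2 : 2 * V ^ 6 * (d : ℝ) ^ 2 / a / d ^ 2 = 2 * V ^ 6 / a := by field_simp
    rw [e1, e2, le_div_iff₀ ha0]
    have e3 : (6 * V ^ 4 / s + 1) * (2 * V ^ 6 / a + 1) * a =
        12 * V ^ 10 / s + 6 * V ^ 4 * s + 2 * V ^ 6 + s ^ 2 := by
      rw [← hss]; field_simp; ring
    rw [e3]
    have i1 : 12 * V ^ 10 / s ≤ 12 * V ^ 9 / d := by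
      rw [div_le_div_iff₀ hs0 hd']
      have := mul_le_mul_of_nonneg_left hVs (by positivity : 0 ≤ 12 * V ^ 9)
      linarith
    gcongr
  · intro p hp q hq b c hb hc hbe hce
    push_cast
    have h1 := (abs_le.mp (hclose p hp b hb hbe)).2
    have h2 := (abs_le.mp (hclose q hq c hc hce)).1
    have h3 := hlow p hp b hb hbe
    have h4 := hlow q hq c hc hce
    rw [le_div_iff₀ hs0]
    by_contra hcon
    push Not at hcon
    have h5 : (0 : ℝ) < b - c := by
      by_contra h
      have : ((b : ℝ) - c) * s ≤ 0 := mul_nonpos_of_nonpos_of_nonneg (by linarith) hs0.le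
      have : 0 < 3 * V ^ 4 * (d : ℝ) ^ 4 := by positivity
      linarith
    have h6 : ((b : ℝ) - c) * s ^ 3 ≤ 3 * (V ^ 4 * a * d ^ 4) := by
      calc ((b : ℝ) - c) * s ^ 3 ≤ (b - c) * (b + c) := by gcongr; linarith
        _ ≤ _ := by linarith
    have h7 := mul_lt_mul_of_pos_right hcon (by positivity : 0 < s ^ 2)
    rw [hss] at h7
    have : ((b : ℝ) - c) * s * a = (b - c) * s ^ 3 := by rw [← hss]; ring
    linarith
  · intro p hp q hq hpq
    have hpq' := congrArg (fun z : ℤ => (z : ℝ)) hpq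
    push_cast at hpq' ⊢
    rw [le_div_iff₀ ha0]
    have h1 := abs_le.mp (hSB p hp)
    have h2 := abs_le.mp (hSB q hq)
    have h3 : ((q.2 : ℝ) - p.2) ≤ 2 * V ^ 6 := by linarith
    have := mul_le_mul_of_nonneg_left h3 (by positivity : 0 ≤ (d : ℝ) ^ 2)
    linarith

/-- Deterministic count of the curves with a point of bounded weighted height. -/
lemma card_curves_with_small_point_le (S : Finset (ℤ × ℤ)) {V m t H : ℝ} (hV : 1 ≤ V)
    (hm : 1 ≤ m) (ht0 : 0 ≤ t) (ht : ∀ d : ℕ, 0 < d → (d : ℝ) ≤ m → ((d ^ 4).divisors.card : ℝ) ≤ t)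
    (hH1 : 1 ≤ H) (hH : ∀ n : ℕ, (n : ℝ) ≤ m ^ 2 → ∑ k ∈ Finset.Icc 1 n, (1 : ℝ) / k ≤ H)
    (hSA : ∀ p ∈ S, |(p.1 : ℝ)| ≤ V ^ 4) (hSB : ∀ p ∈ S, |(p.2 : ℝ)| ≤ V ^ 6)
    (hS : ∀ p ∈ S, ∃ a b : ℤ, ∃ d : ℕ, 0 < d ∧ IsCoprime a d ∧ IsCoprime b d ∧
      |(a : ℝ)| ≤ m ^ 2 ∧ V ^ 2 * d ^ 2 ≤ m ^ 2 ∧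
      b ^ 2 = a ^ 3 + p.1 * a * d ^ 4 + p.2 * d ^ 6) :
    (S.card : ℝ) ≤ 100 * t * H ^ 2 * (V ^ 9 + V ^ 5 * m + V ^ 3 * m ^ 2 + m ^ 3 / V) := by
  classical
  have hV0 : 0 < V := by linarith
  have hm0 : 0 < m := by linarith
  let F : ℕ → ℤ → Finset (ℤ × ℤ) := fun d a => S.filter (fun p => IsCoprime a d ∧
    ∃ b : ℤ, IsCoprime b d ∧ 0 ≤ b ∧ b ^ 2 = a ^ 3 + p.1 * a * d ^ 4 + p.2 * d ^ 6)
  set D : ℕ := ⌊m / V⌋₊ with hD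
  set M : ℕ := ⌊m ^ 2⌋₊ with hM
  have hDm : (D : ℝ) ≤ m / V := Nat.floor_le (by positivity)
  have hDm' : (D : ℝ) ≤ m := hDm.trans (div_le_self hm0.le hV)
  have hdD : ∀ d ∈ Finset.Icc 1 D, (0 : ℝ) < d ∧ (d : ℝ) ≤ m / V ∧ (d : ℝ) ≤ m := by
    intro d hd
    rw [Finset.mem_Icc] at hd
    have : (d : ℝ) ≤ D := by exact_mod_cast hd.2
    exact ⟨by exact_mod_cast hd.1, by linarith, by linarith⟩
  let N : ℕ → ℤ := fun d => ⌊2 * V ^ 2 * (d : ℝ) ^ 2⌋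
  let F₁ : ℕ → Finset (ℤ × ℤ) := fun d => (Finset.Icc (-N d) (N d)).biUnion (F d)
  let F₂ : ℕ → Finset (ℤ × ℤ) := fun d =>
    (Finset.Icc 1 M).biUnion (fun k => if 2 * V ^ 2 * (d : ℝ) ^ 2 < k then F d k else ∅)
  have hsub : S ⊆ (Finset.Icc 1 D).biUnion (fun d => F₁ d ∪ F₂ d) := by
    intro p hp
    obtain ⟨a, b, d, hd, had, hbd, ha, hdm, he⟩ := hS p hp
    have hd' : (0 : ℝ) < d := by exact_mod_cast hd
    have hpF : p ∈ F d a := by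
      refine Finset.mem_filter.mpr ⟨hp, had, |b|, ?_, abs_nonneg b, by rw [sq_abs, he]⟩
      exact IsCoprime.abs_left hbd
    have hdD' : d ∈ Finset.Icc 1 D := by
      rw [Finset.mem_Icc]
      refine ⟨hd, Nat.le_floor ?_⟩
      rw [le_div_iff₀ hV0]
      refine (sq_le_sq₀ (by positivity) hm0.le).mp ?_
      linarith
    refine Finset.mem_biUnion.mpr ⟨d, hdD', ?_⟩
    rw [Finset.mem_union]
    by_cases hsm : |(a : ℝ)| ≤ 2 * V ^ 2 * d ^ 2
    · left
      refine Finset.mem_biUnion.mpr ⟨a, ?_, hpF⟩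
      have := abs_le.mp hsm
      rw [Finset.mem_Icc]
      refine ⟨?_, Int.le_floor.mpr this.2⟩
      have h1 : -a ≤ N d := Int.le_floor.mpr (by push_cast; linarith)
      linarith
    · right
      push Not at hsm
      have hapos : 0 < a := by
        by_contra hneg
        push Not at hneg
        have hneg' : (a : ℝ) ≤ 0 := by exact_mod_cast hneg
        rw [abs_of_nonpos hneg'] at hsm
        have he' := congrArg (fun z : ℤ => (z : ℝ)) he
        push_cast at he'
        set u : ℝ := -a with hu
        have hua : (a : ℝ) = -u := by rw [hu]; ring
        rw [hua] at he'
        have hu0 : 0 < u := lt_trans (by positivity) hsm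
        have hA := abs_le.mp (hSA p hp)
        have hB := abs_le.mp (hSB p hp)
        have i1 : -((p.1 : ℝ) * u * d ^ 4) ≤ V ^ 4 * u * d ^ 4 := by
          rw [← neg_mul, ← neg_mul]; gcongr; linarith
        have i2 : (p.2 : ℝ) * d ^ 6 ≤ V ^ 6 * d ^ 6 := by gcongr; linarith
        have i3 : V ^ 6 * (d : ℝ) ^ 6 ≤ V ^ 4 * u * d ^ 4 := by
          have : 0 < V ^ 4 * (d : ℝ) ^ 4 := by positivity
          have : 0 < V ^ 2 * (d : ℝ) ^ 2 := by positivity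
          nlinarith
        have i4 : 4 * (V ^ 4 * u * d ^ 4) < u ^ 3 := by
          have h3 : (2 * V ^ 2 * (d : ℝ) ^ 2) ^ 2 < u ^ 2 := by gcongr
          nlinarith
        have : 0 ≤ V ^ 4 * u * (d : ℝ) ^ 4 := by positivity
        nlinarith [sq_nonneg (b : ℝ)]
      lift a to ℕ using hapos.le
      refine Finset.mem_biUnion.mpr ⟨a, ?_, ?_⟩
      · rw [Finset.mem_Icc]
        refine ⟨by exact_mod_cast hapos, Nat.le_floor ?_⟩
        have := (abs_le.mp ha).2
        exact_mod_cast this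
      · rw [if_pos]
        · exact hpF
        · simpa using hsm
  have hcard₁ : ∀ d ∈ Finset.Icc 1 D, ((F₁ d).card : ℝ) ≤
      5 * t * (16 * V ^ 9 * (1 / d) + 2 * V ^ 5 * m / D + 8 * V ^ 3 * m ^ 2 / D + m ^ 3 / V / D) := by
    intro d hd
    obtain ⟨hd0, hdV, hdm⟩ := hdD d hd
    have hdn : 0 < d := by exact_mod_cast hd0
    have hD0 : (0 : ℝ) < D := by
      have := (Finset.mem_Icc.mp hd).2
      exact_mod_cast lt_of_lt_of_le hdn this
    have h1 : ∀ a ∈ Finset.Icc (-N d) (N d), ((F d a).card : ℝ) ≤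
        t * (8 * V ^ 3 / d + 1) * (2 * V ^ 4 / d ^ 2 + 1) := by
      intro a ha
      rcases (F d a).eq_empty_or_nonempty with he | ⟨p₀, hp₀⟩
      · rw [he]; simp only [Finset.card_empty, Nat.cast_zero]; positivity
      have hF : ∀ p ∈ F d a, p ∈ S := fun p hp => (Finset.mem_filter.mp hp).1
      refine (card_curves_through_le_of_small (F d a) hdn (Finset.mem_filter.mp hp₀).2.1 hV0
        (fun p hp => hSA p (hF p hp)) (fun p hp => hSB p (hF p hp))
        (fun p hp => (Finset.mem_filter.mp hp).2.2) ?_).trans ?_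
      · rw [Finset.mem_Icc] at ha
        have h2 : ((N d : ℤ) : ℝ) ≤ 2 * V ^ 2 * d ^ 2 := Int.floor_le _
        have h3 : (a : ℝ) ≤ N d := by exact_mod_cast ha.2
        have h4 : -((N d : ℤ) : ℝ) ≤ a := by exact_mod_cast ha.1
        exact abs_le.mpr ⟨by linarith, by linarith⟩
      · gcongr
        exact ht d hdn hdm
    have h2 : ((Finset.Icc (-N d) (N d)).card : ℝ) ≤ 5 * (V ^ 2 * d ^ 2) := by
      have hN0 : 0 ≤ N d := Int.floor_nonneg.mpr (by positivity)
      have h3 : (((Finset.Icc (-N d) (N d)).card : ℤ) : ℝ) = ((N d + 1 - (-N d) : ℤ) : ℝ) := by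
        rw [Int.card_Icc, Int.toNat_of_nonneg (by linarith)]
      have h4 : ((N d : ℤ) : ℝ) ≤ 2 * V ^ 2 * d ^ 2 := Int.floor_le _
      have h5 : 1 ≤ V ^ 2 * (d : ℝ) ^ 2 := by
        have hd1 : (1 : ℝ) ≤ d := by exact_mod_cast hdn
        exact one_le_mul_of_one_le_of_one_le (one_le_pow₀ hV) (one_le_pow₀ hd1)
      push_cast at h3
      linarith
    have h3 : ((F₁ d).card : ℝ) ≤ ∑ a ∈ Finset.Icc (-N d) (N d), ((F d a).card : ℝ) := by
      exact_mod_cast Finset.card_biUnion_le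
    refine (h3.trans (Finset.sum_le_sum h1)).trans ?_
    rw [Finset.sum_const, nsmul_eq_mul]
    have hdD1 : (d : ℝ) ≤ D := by exact_mod_cast (Finset.mem_Icc.mp hd).2
    have hVD : V * D ≤ m := by rw [le_div_iff₀ hV0] at hDm; linarith
    have hVd : V * d ≤ m := by rw [le_div_iff₀ hV0] at hdV; linarith
    have j1 : V ^ 5 * d ≤ V ^ 3 * m ^ 2 / D := by
      rw [le_div_iff₀ hD0]
      calc V ^ 5 * d * D = V ^ 3 * ((V * d) * (V * D)) := by ring
        _ ≤ V ^ 3 * (m * m) := by gcongr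
        _ = _ := by ring
    have j2 : V ^ 6 ≤ V ^ 5 * m / D := by
      rw [le_div_iff₀ hD0]
      calc V ^ 6 * D = V ^ 5 * (V * D) := by ring
        _ ≤ _ := by gcongr
    have j3 : V ^ 2 * (d : ℝ) ^ 2 ≤ m ^ 3 / V / D := by
      rw [le_div_iff₀ hD0, le_div_iff₀ hV0]
      calc V ^ 2 * (d : ℝ) ^ 2 * D * V = (V * d) * (V * d) * (V * D) := by ring
        _ ≤ m * m * m := by gcongr
        _ = _ := by ring
    calc ((Finset.Icc (-N d) (N d)).card : ℝ) * (t * (8 * V ^ 3 / d + 1) * (2 * V ^ 4 / d ^ 2 + 1))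
        ≤ 5 * (V ^ 2 * d ^ 2) * (t * (8 * V ^ 3 / d + 1) * (2 * V ^ 4 / d ^ 2 + 1)) := by gcongr
      _ = 5 * t * (16 * V ^ 9 * (1 / d) + 2 * V ^ 6 + 8 * (V ^ 5 * d) + V ^ 2 * d ^ 2) := by
        field_simp; ring
      _ ≤ 5 * t * (16 * V ^ 9 * (1 / d) + 2 * (V ^ 5 * m / D) + 8 * (V ^ 3 * m ^ 2 / D) +
          m ^ 3 / V / D) := by gcongr
      _ = _ := by ring
  have hcard₂ : ∀ d ∈ Finset.Icc 1 D, ((F₂ d).card : ℝ) ≤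
      t * H * (12 * V ^ 9 * (1 / d) + 6 * V ^ 3 * m ^ 2 / D + 2 * V ^ 5 * m / D +
        m ^ 3 / V / D) := by
    intro d hd
    obtain ⟨hd0, hdV, hdm⟩ := hdD d hd
    have hdn : 0 < d := by exact_mod_cast hd0
    have hD0 : (0 : ℝ) < D := by
      have := (Finset.mem_Icc.mp hd).2
      exact_mod_cast lt_of_lt_of_le hdn this
    set R : ℝ := 12 * V ^ 9 / d + 6 * V ^ 4 * m + 2 * V ^ 6 + m ^ 2 with hR
    have hR0 : 0 ≤ R := by positivity
    have h1 : ∀ k ∈ Finset.Icc 1 M,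
        (((if 2 * V ^ 2 * (d : ℝ) ^ 2 < k then F d k else ∅).card : ℕ) : ℝ) ≤
          t * R * (1 / k) := by
      intro k hk
      split_ifs with hlt
      · rcases (F d k).eq_empty_or_nonempty with he | ⟨p₀, hp₀⟩
        · rw [he]; simp only [Finset.card_empty, Nat.cast_zero]; positivity
        have hF : ∀ p ∈ F d k, p ∈ S := fun p hp => (Finset.mem_filter.mp hp).1
        have hkM : (k : ℝ) ≤ m ^ 2 :=
          (Nat.le_floor_iff (by positivity)).mp (Finset.mem_Icc.mp hk).2
        refine (card_curves_through_le_of_large (F d k) hdn (Finset.mem_filter.mp hp₀).2.1 hV0 hm0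
          (fun p hp => hSA p (hF p hp)) (fun p hp => hSB p (hF p hp))
          (fun p hp => (Finset.mem_filter.mp hp).2.2) (by simpa using hlt)
          (by simpa using hkM)).trans ?_
        rw [Int.cast_natCast, show t * R * (1 / (k : ℝ)) = t * (R / k) by ring]
        exact mul_le_mul_of_nonneg_right (ht d hdn hdm) (by positivity)
      · simp only [Finset.card_empty, Nat.cast_zero]; positivity
    have h3 : ((F₂ d).card : ℝ) ≤ ∑ k ∈ Finset.Icc 1 M,
        (((if 2 * V ^ 2 * (d : ℝ) ^ 2 < k then F d k else ∅).card : ℕ) : ℝ) :=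
      (Nat.cast_le.mpr Finset.card_biUnion_le).trans (Nat.cast_sum _ _).le
    refine (h3.trans (Finset.sum_le_sum h1)).trans ?_
    rw [← Finset.mul_sum]
    have h4 := hH M (Nat.floor_le (by positivity))
    have hVD : V * D ≤ m := by rw [le_div_iff₀ hV0] at hDm; linarith
    have j1 : V ^ 4 * m ≤ V ^ 3 * m ^ 2 / D := by
      rw [le_div_iff₀ hD0]
      calc V ^ 4 * m * D = V ^ 3 * (m * (V * D)) := by ring
        _ ≤ V ^ 3 * (m * m) := by gcongr
        _ = _ := by ring
    have j2 : V ^ 6 ≤ V ^ 5 * m / D := by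
      rw [le_div_iff₀ hD0]
      calc V ^ 6 * D = V ^ 5 * (V * D) := by ring
        _ ≤ _ := by gcongr
    have j3 : m ^ 2 ≤ m ^ 3 / V / D := by
      rw [le_div_iff₀ hD0, le_div_iff₀ hV0]
      calc m ^ 2 * D * V = m ^ 2 * (V * D) := by ring
        _ ≤ m ^ 2 * m := by gcongr
        _ = _ := by ring
    calc t * R * ∑ k ∈ Finset.Icc 1 M, (1 : ℝ) / k ≤ t * R * H := by gcongr
      _ = t * H * (12 * V ^ 9 * (1 / d) + 6 * (V ^ 4 * m) + 2 * V ^ 6 + m ^ 2) := by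
        rw [hR]; ring
      _ ≤ t * H * (12 * V ^ 9 * (1 / d) + 6 * (V ^ 3 * m ^ 2 / D) + 2 * (V ^ 5 * m / D) +
          m ^ 3 / V / D) := by gcongr
      _ = _ := by ring
  have hSc : (S.card : ℝ) ≤ ∑ d ∈ Finset.Icc 1 D, (((F₁ d).card : ℝ) + (F₂ d).card) := by
    have h1 := (Finset.card_le_card hsub).trans Finset.card_biUnion_le
    have h2 := h1.trans (Finset.sum_le_sum fun d _ => Finset.card_union_le (F₁ d) (F₂ d))
    exact_mod_cast h2
  have hsumD : ∑ d ∈ Finset.Icc 1 D, (1 : ℝ) / d ≤ H :=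
    hH D (hDm'.trans (by nlinarith))
  have hconst : ∑ _d ∈ Finset.Icc 1 D, (1 : ℝ) / D ≤ 1 := by
    rw [Finset.sum_const, nsmul_eq_mul, Nat.card_Icc, Nat.add_sub_cancel, mul_one_div]
    exact div_self_le_one _
  have hH2 : H ≤ H ^ 2 := by nlinarith
  set Y₁ := V ^ 9
  set Y₂ := V ^ 5 * m
  set Y₃ := V ^ 3 * m ^ 2
  set Y₄ := m ^ 3 / V
  have p1 : 0 ≤ Y₁ := by positivity
  have p2 : 0 ≤ Y₂ := by positivity
  have p3 : 0 ≤ Y₃ := by positivity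
  have p4 : 0 ≤ Y₄ := by positivity
  have hbig : ∀ d ∈ Finset.Icc 1 D, (((F₁ d).card : ℝ) + (F₂ d).card) ≤
      t * H * (92 * Y₁) * (1 / d) + t * H * (16 * Y₂ + 46 * Y₃ + 6 * Y₄) * (1 / D) := by
    intro d hd
    have h1 := hcard₁ d hd
    have h2 := hcard₂ d hd
    have e1 : 5 * t * (16 * V ^ 9 * (1 / d) + 2 * V ^ 5 * m / D + 8 * V ^ 3 * m ^ 2 / D +
        m ^ 3 / V / D) = t * 1 * (80 * Y₁ * (1 / d) + (10 * Y₂ + 40 * Y₃ + 5 * Y₄) * (1 / D)) := by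
      ring
    rw [e1] at h1
    have h3 : t * 1 * (80 * Y₁ * (1 / d) + (10 * Y₂ + 40 * Y₃ + 5 * Y₄) * (1 / (D : ℝ))) ≤
      t * H * (80 * Y₁ * (1 / d) + (10 * Y₂ + 40 * Y₃ + 5 * Y₄) * (1 / D)) := by gcongr
    have e2 : t * H * (12 * V ^ 9 * (1 / d) + 6 * V ^ 3 * m ^ 2 / D + 2 * V ^ 5 * m / D +
        m ^ 3 / V / D) = t * H * (12 * Y₁ * (1 / d) + (2 * Y₂ + 6 * Y₃ + Y₄) * (1 / D)) := by
      ring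
    rw [e2] at h2
    have h4 : 0 ≤ t * H * Y₂ * (1 / D) := by positivity
    linarith
  refine (hSc.trans (Finset.sum_le_sum hbig)).trans ?_
  rw [Finset.sum_add_distrib, ← Finset.mul_sum, ← Finset.mul_sum]
  calc _ ≤ t * H * (92 * Y₁) * H + t * H * (16 * Y₂ + 46 * Y₃ + 6 * Y₄) * 1 := by gcongr
    _ ≤ t * H * (92 * Y₁) * H + t * H * (16 * Y₂ + 46 * Y₃ + 6 * Y₄) * H := by gcongr
    _ = t * H ^ 2 * (92 * Y₁ + 16 * Y₂ + 46 * Y₃ + 6 * Y₄) := by ring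
    _ ≤ t * H ^ 2 * (100 * (Y₁ + Y₂ + Y₃ + Y₄)) := by gcongr; linarith
    _ = _ := by ring

lemma card_le_card_mul_of_fiber_le {α β : Type*} [DecidableEq β] (S : Finset α) (U : Finset β)
    (f : α → β) {c : ℝ} (hf : ∀ x ∈ S, f x ∈ U)
    (hc : ∀ u ∈ U, ((S.filter (fun x => f x = u)).card : ℝ) ≤ c) :
    (S.card : ℝ) ≤ U.card * c := by
  rw [Finset.card_eq_sum_card_fiberwise hf, Nat.cast_sum, ← nsmul_eq_mul]
  exact Finset.sum_le_card_nsmul _ _ _ hc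

/-- The integers of absolute value at most `R`. -/
noncomputable def intBall (R : ℝ) : Finset ℤ := Finset.Icc (-⌊R⌋) ⌊R⌋

lemma mem_intBall {R : ℝ} {a : ℤ} : a ∈ intBall R ↔ |(a : ℝ)| ≤ R := by
  rw [intBall, Finset.mem_Icc, abs_le, Int.le_floor, neg_le, Int.le_floor, neg_le]
  push_cast
  rw [neg_le]

lemma card_intBall_le {R : ℝ} (hR : 1 ≤ R) : ((intBall R).card : ℝ) ≤ 3 * R := by
  have hN0 : 0 ≤ ⌊R⌋ := Int.floor_nonneg.mpr (by linarith)
  have h3 : (((intBall R).card : ℤ) : ℝ) = ((⌊R⌋ + 1 - (-⌊R⌋) : ℤ) : ℝ) := by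
    rw [intBall, Int.card_Icc, Int.toNat_of_nonneg (by linarith)]
  have h4 : ((⌊R⌋ : ℤ) : ℝ) ≤ R := Int.floor_le _
  push_cast at h3
  linarith

lemma card_le_of_sub_le (S : Finset ℤ) {L : ℝ} (hL : 0 ≤ L)
    (hlen : ∀ x ∈ S, ∀ y ∈ S, ((x - y : ℤ) : ℝ) ≤ L) : (S.card : ℝ) ≤ L + 1 := by
  have := card_le_of_pairwise_dvd_sub S one_pos hL hlen (fun x _ y _ => by simp)
  simpa using this

/-- There are few pairs `(A, B)` of small discriminant. -/
lemma card_small_disc_le (S : Finset (ℤ × ℤ)) {V L : ℝ} (hV : 1 ≤ V) (hL : 0 ≤ L)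
    (hSA : ∀ p ∈ S, |(p.1 : ℝ)| ≤ V ^ 4)
    (hS : ∀ p ∈ S, |(4 * p.1 ^ 3 + 27 * p.2 ^ 2 : ℝ)| ≤ L ^ 2) :
    (S.card : ℝ) ≤ 6 * V ^ 4 * (L + 1) := by
  have hV4 : 1 ≤ V ^ 4 := one_le_pow₀ hV
  have h1 := card_le_card_mul_of_fiber_le S (intBall (V ^ 4)) Prod.fst (c := 2 * (L + 1))
    (fun p hp => mem_intBall.mpr (hSA p hp)) ?_
  · have := card_intBall_le hV4
    calc (S.card : ℝ) ≤ _ := h1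
      _ ≤ 3 * V ^ 4 * (2 * (L + 1)) := by gcongr
      _ = _ := by ring
  intro A _
  set T := (S.filter (fun p => p.1 = A)).image Prod.snd with hT
  have hinj : Set.InjOn Prod.snd (S.filter (fun p => p.1 = A) : Set (ℤ × ℤ)) := by
    intro p hp q hq hpq
    simp only [Finset.coe_filter, Set.mem_ofPred_eq] at hp hq
    exact Prod.ext (hp.2.trans hq.2.symm) hpq
  rw [← Finset.card_image_of_injOn hinj, ← hT]
  have hTB : ∀ B ∈ T, |(4 * A ^ 3 + 27 * B ^ 2 : ℝ)| ≤ L ^ 2 := by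
    intro B hB
    simp only [hT, Finset.mem_image, Finset.mem_filter] at hB
    obtain ⟨p, ⟨hp, rfl⟩, rfl⟩ := hB
    exact hS p hp
  have hsq : ∀ x ∈ T, ∀ y ∈ T, (x : ℝ) ^ 2 - y ^ 2 ≤ L ^ 2 := by
    intro x hx y hy
    have h2 := abs_le.mp (hTB x hx)
    have h3 := abs_le.mp (hTB y hy)
    nlinarith [sq_nonneg L]
  have hpos : ((T.filter (fun x => 0 ≤ x)).card : ℝ) ≤ L + 1 := by
    refine card_le_of_sub_le _ hL (fun x hx y hy => ?_)
    rw [Finset.mem_filter] at hx hy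
    have h2 := hsq x hx.1 y hy.1
    have hy0 : (0 : ℝ) ≤ y := by exact_mod_cast hy.2
    push_cast
    by_contra hcon
    push Not at hcon
    nlinarith
  have hneg : ((T.filter (fun x => ¬0 ≤ x)).card : ℝ) ≤ L + 1 := by
    refine card_le_of_sub_le _ hL (fun x hx y hy => ?_)
    rw [Finset.mem_filter] at hx hy
    have h2 := hsq y hy.1 x hx.1
    have hx0 : (x : ℝ) ≤ 0 := by exact_mod_cast (not_le.mp hx.2).le
    push_cast
    by_contra hcon
    push Not at hcon
    nlinarith
  rw [← Finset.card_filter_add_card_filter_not (fun x => 0 ≤ x)]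
  push_cast
  linarith

lemma card_fst_eq_zero_le (S : Finset (ℤ × ℤ)) {V : ℝ} (hV : 1 ≤ V)
    (hSA : ∀ p ∈ S, p.1 = 0) (hSB : ∀ p ∈ S, |(p.2 : ℝ)| ≤ V ^ 6) :
    (S.card : ℝ) ≤ 3 * V ^ 6 := by
  have hinj : Set.InjOn Prod.snd (S : Set (ℤ × ℤ)) := fun p hp q hq hpq =>
    Prod.ext ((hSA p hp).trans (hSA q hq).symm) hpq
  rw [← Finset.card_image_of_injOn hinj]
  refine le_trans ?_ (card_intBall_le (one_le_pow₀ hV : 1 ≤ V ^ 6))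
  refine Nat.cast_le.mpr (Finset.card_le_card ?_)
  intro B hB
  obtain ⟨p, hp, rfl⟩ := Finset.mem_image.mp hB
  exact mem_intBall.mpr (hSB p hp)

lemma dvd_floorRoot_three_mul {c n : ℕ} (hc : c ≠ 0) (hn : n ≠ 0) (h : c ^ 2 ∣ n ^ 3) :
    c ∣ Nat.floorRoot 3 c * n := by
  have hr : Nat.floorRoot 3 c ≠ 0 := by simp [hc]
  rw [← Nat.factorization_le_iff_dvd (pow_ne_zero 2 hc) (pow_ne_zero 3 hn)] at h
  rw [← Nat.factorization_le_iff_dvd hc (mul_ne_zero hr hn), Nat.factorization_mul hr hn,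
    Nat.factorization_floorRoot]
  intro p
  have := h p
  simp only [Nat.factorization_pow, Finsupp.smul_apply, smul_eq_mul, Finsupp.add_apply,
    Finsupp.floorDiv_apply, Nat.floorDiv_eq_div] at this ⊢
  lia

/-- The number of nonzero `A` in a box such that `48 A³` is divisible by a given square. -/
lemma mul_card_sq_dvd_cube_le {c : ℕ} (hc : 0 < c) {R : ℝ} (hR : 1 ≤ R) :
    (c : ℝ) * ((intBall R).filter (fun A => A ≠ 0 ∧ (c : ℤ) ^ 2 ∣ 48 * A ^ 3)).card ≤
      150 * R * Nat.floorRoot 3 c := by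
  set r := Nat.floorRoot 3 c with hr
  have hr0 : 0 < r := Nat.pos_of_ne_zero (by simp [hr, hc.ne'])
  have hrc : r ∣ c := (dvd_pow_self r three_ne_zero).trans (Nat.floorRoot_pow_dvd)
  obtain ⟨e, he⟩ := hrc
  have he0 : 0 < e := Nat.pos_of_ne_zero (by rintro rfl; simp at he; lia)
  set T := (intBall R).filter (fun A => A ≠ 0 ∧ (c : ℤ) ^ 2 ∣ 48 * A ^ 3) with hT
  have hdvd : ∀ A ∈ T, (e : ℤ) ∣ 48 * A := by
    intro A hA
    obtain ⟨-, hA0, h2⟩ := Finset.mem_filter.mp hA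
    have h3 : c ^ 2 ∣ (48 * A.natAbs) ^ 3 := by
      have h4 : (c : ℤ) ^ 2 ∣ (48 * A) ^ 3 := h2.trans ⟨48 ^ 2, by ring⟩
      have := Int.natAbs_dvd_natAbs.mpr h4
      simpa [Int.natAbs_mul, Int.natAbs_pow] using this
    have h5 := dvd_floorRoot_three_mul hc.ne' (by simpa using hA0) h3
    rw [← hr] at h5
    nth_rewrite 1 [he] at h5
    have h6 := Nat.dvd_of_mul_dvd_mul_left hr0 h5
    have : (48 * A).natAbs = 48 * A.natAbs := by simp [Int.natAbs_mul]
    rw [← this] at h6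
    exact Int.natCast_dvd.mpr h6
  have hsub : (e : ℝ) * T.card ≤ 150 * R := by
    rcases T.eq_empty_or_nonempty with h0 | ⟨A₀, hA₀⟩
    · rw [h0]; simp; linarith
    have h1 := card_le_of_pairwise_dvd_sub (T.image (fun A => 48 * A)) he0 (L := 96 * R)
      (by positivity) ?_ ?_
    · rw [Finset.card_image_of_injective _ (fun a b h => by simpa using h)] at h1
      have he' : (0 : ℝ) < e := by exact_mod_cast he0
      have h2 : (e : ℝ) ≤ 48 * R := by
        have h3 := (Finset.mem_filter.mp hA₀)
        have h4 := Int.le_of_dvd (abs_pos.mpr (by simpa using h3.2.1)) ((dvd_abs _ _).mpr (hdvd A₀ hA₀))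
        have h5 := mem_intBall.mp h3.1
        have h6 : (e : ℝ) ≤ |48 * (A₀ : ℝ)| := by exact_mod_cast h4
        rw [abs_mul] at h6
        norm_num at h6
        linarith
      have h7 := mul_le_mul_of_nonneg_left h1 he'.le
      rw [mul_add, mul_div_cancel₀ _ he'.ne'] at h7
      linarith
    · simp only [Finset.forall_mem_image]
      intro x hx y hy
      have h1 := abs_le.mp (mem_intBall.mp (Finset.mem_filter.mp hx).1)
      have h2 := abs_le.mp (mem_intBall.mp (Finset.mem_filter.mp hy).1)
      push_cast
      linarith
    · simp only [Finset.forall_mem_image]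
      intro x hx y hy
      exact dvd_sub (hdvd x hx) (hdvd y hy)
  have hrR : (0 : ℝ) ≤ r := Nat.cast_nonneg _
  have := mul_le_mul_of_nonneg_left hsub hrR
  rw [he]
  push_cast
  linarith

lemma sum_floorRoot_div_sq_le {P H : ℝ} (hP : 0 < P) (Q : ℕ)
    (hH : ∑ k ∈ Finset.Icc 1 Q, (1 : ℝ) / k ≤ H) :
    ∑ q ∈ (Finset.Icc 1 Q).filter (fun q : ℕ => P < q), (Nat.floorRoot 3 q : ℝ) / (q : ℝ) ^ 2 ≤
      H ^ 2 / P := by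
  have hH0 : 0 ≤ H := le_trans (Finset.sum_nonneg fun _ _ => by positivity) hH
  set U := (Finset.Icc 1 Q).filter (fun q : ℕ => P < q) with hU
  let f : ℕ → ℕ × ℕ := fun q => (Nat.floorRoot 3 q, q / Nat.floorRoot 3 q ^ 3)
  have hfac : ∀ q : ℕ, (f q).1 ^ 3 * (f q).2 = q := fun q =>
    Nat.mul_div_cancel' Nat.floorRoot_pow_dvd
  have hinj : Set.InjOn f (U : Set ℕ) := fun a _ b _ hab => by
    rw [← hfac a, ← hfac b, hab]
  have hmaps : ∀ q ∈ U, f q ∈ Finset.Icc 1 Q ×ˢ Finset.Icc 1 Q := by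
    intro q hq
    have hq1 := Finset.mem_Icc.mp (Finset.mem_filter.mp hq).1
    have hfq := hfac q
    have h1 : 0 < (f q).1 := Nat.pos_of_ne_zero (by intro h; rw [h] at hfq; simp at hfq; lia)
    have h2 : 0 < (f q).2 := Nat.pos_of_ne_zero (by intro h; rw [h] at hfq; simp at hfq; lia)
    have h3 : (f q).1 ∣ q := (dvd_pow_self _ three_ne_zero).trans ⟨_, hfq.symm⟩
    have h4 : (f q).2 ∣ q := ⟨_, by rw [mul_comm]; exact hfq.symm⟩
    rw [Finset.mem_product, Finset.mem_Icc, Finset.mem_Icc]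
    exact ⟨⟨h1, (Nat.le_of_dvd hq1.1 h3).trans hq1.2⟩, ⟨h2, (Nat.le_of_dvd hq1.1 h4).trans hq1.2⟩⟩
  calc ∑ q ∈ U, (Nat.floorRoot 3 q : ℝ) / (q : ℝ) ^ 2
      ≤ ∑ q ∈ U, 1 / P * (1 / ((f q).1 : ℝ) * (1 / (f q).2)) := by
        refine Finset.sum_le_sum fun q hq => ?_
        have hPq : P < q := (Finset.mem_filter.mp hq).2
        have h1 := (Finset.mem_product.mp (hmaps q hq))
        have hr : (1 : ℝ) ≤ ((f q).1 : ℝ) := by exact_mod_cast (Finset.mem_Icc.mp h1.1).1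
        have hk : (1 : ℝ) ≤ ((f q).2 : ℝ) := by exact_mod_cast (Finset.mem_Icc.mp h1.2).1
        have hq' : (q : ℝ) = ((f q).1 : ℝ) ^ 3 * (f q).2 := by exact_mod_cast (hfac q).symm
        change ((f q).1 : ℝ) / _ ≤ _
        set r : ℝ := ((f q).1 : ℝ)
        set k : ℝ := ((f q).2 : ℝ)
        have hr0 : 0 < r := by linarith
        have hk0 : 0 < k := by linarith
        have hq0 : (0 : ℝ) < q := by linarith
        have e1 : 1 / P * (1 / r * (1 / k)) = r / (P * (r ^ 2 * k)) := by field_simp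
        rw [e1]
        refine div_le_div_of_nonneg_left hr0.le (by positivity) ?_
        have i1 : r ^ 2 * k ≤ q := by
          rw [hq', pow_succ]; nlinarith [mul_pos (pow_pos hr0 2) hk0]
        rw [sq (q : ℝ)]
        exact mul_le_mul hPq.le i1 (by positivity) hq0.le
    _ = ∑ z ∈ U.image f, 1 / P * (1 / (z.1 : ℝ) * (1 / z.2)) :=
        (Finset.sum_image (f := fun z : ℕ × ℕ => 1 / P * (1 / (z.1 : ℝ) * (1 / z.2))) hinj).symm
    _ ≤ ∑ z ∈ Finset.Icc 1 Q ×ˢ Finset.Icc 1 Q, 1 / P * (1 / (z.1 : ℝ) * (1 / z.2)) :=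
        Finset.sum_le_sum_of_subset_of_nonneg
          (fun z hz => by
            obtain ⟨q, hq, rfl⟩ := Finset.mem_image.mp hz
            exact hmaps q hq) (fun _ _ _ => by positivity)
    _ = 1 / P * ((∑ k ∈ Finset.Icc 1 Q, (1 : ℝ) / k) * ∑ k ∈ Finset.Icc 1 Q, (1 : ℝ) / k) := by
        rw [← Finset.mul_sum, Finset.sum_product, Finset.sum_mul_sum]
    _ ≤ 1 / P * (H * H) := by
        have : (0 : ℝ) ≤ ∑ k ∈ Finset.Icc 1 Q, (1 : ℝ) / k :=
          Finset.sum_nonneg fun _ _ => by positivity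
        gcongr
    _ = H ^ 2 / P := by ring

/-- There are few pairs `(A, B)` whose discriminant is divisible by the square of an integer of
medium size. -/
lemma card_medium_sq_dvd_le (S : Finset (ℤ × ℤ)) {V P t H : ℝ} {Q : ℕ} (hV : 1 ≤ V) (hP : 0 < P)
    (ht0 : 0 ≤ t) (ht : ∀ q : ℕ, 0 < q → q ≤ Q → ((q ^ 2).divisors.card : ℝ) ≤ t)
    (hH : ∑ k ∈ Finset.Icc 1 Q, (1 : ℝ) / k ≤ H)
    (hSA : ∀ p ∈ S, |(p.1 : ℝ)| ≤ V ^ 4) (hSB : ∀ p ∈ S, |(p.2 : ℝ)| ≤ V ^ 6)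
    (hS : ∀ p ∈ S, p.1 ≠ 0 ∧ ∃ q : ℕ, P < q ∧ q ≤ Q ∧
      (q : ℤ) ^ 2 ∣ (9 * p.2) ^ 2 + 12 * p.1 ^ 3) :
    (S.card : ℝ) ≤ 2700 * t ^ 2 * H ^ 2 * V ^ 10 / P + 3 * t * V ^ 4 * Q := by
  classical
  set U := (Finset.Icc 1 Q).filter (fun q : ℕ => P < q) with hU
  set Y := (intBall (V ^ 4)).filter (fun A => A ≠ 0) with hY
  let F : ℕ → ℤ → Finset (ℤ × ℤ) := fun q A => S.filter (fun p => p.1 = A ∧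
    (q : ℤ) ^ 2 ∣ (9 * p.2) ^ 2 + 12 * A ^ 3)
  let C : ℕ → ℤ → ℝ := fun q A =>
    ∑ c ∈ q.divisors.filter (fun c : ℕ => (c : ℤ) ^ 2 ∣ 48 * A ^ 3), (c : ℝ)
  have hV4 : 1 ≤ V ^ 4 := one_le_pow₀ hV
  have hsub : S ⊆ U.biUnion (fun q => Y.biUnion (F q)) := by
    intro p hp
    obtain ⟨h0, q, hPq, hqQ, hdvd⟩ := hS p hp
    have hq0 : 1 ≤ q := by
      have : (0 : ℝ) < q := hP.trans hPq
      exact_mod_cast this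
    exact Finset.mem_biUnion.mpr ⟨q, Finset.mem_filter.mpr ⟨Finset.mem_Icc.mpr ⟨hq0, hqQ⟩, hPq⟩,
      Finset.mem_biUnion.mpr ⟨p.1, Finset.mem_filter.mpr ⟨mem_intBall.mpr (hSA p hp), h0⟩,
        Finset.mem_filter.mpr ⟨hp, rfl, hdvd⟩⟩⟩
  have hF : ∀ q ∈ U, ∀ A ∈ Y, ((F q A).card : ℝ) ≤ t * (C q A * (18 * V ^ 6) / q ^ 2 + 1) := by
    intro q hq A _
    obtain ⟨hq1, hqQ⟩ := Finset.mem_Icc.mp (Finset.mem_filter.mp hq).1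
    have hC0 : 0 ≤ C q A := Finset.sum_nonneg fun _ _ => by positivity
    have hinj : Set.InjOn (fun p : ℤ × ℤ => 9 * p.2) (F q A : Set (ℤ × ℤ)) := by
      intro p hp p' hp' h
      have h1 := (Finset.mem_filter.mp hp).2.1
      have h2 := (Finset.mem_filter.mp hp').2.1
      simp only at h
      exact Prod.ext (h1.trans h2.symm) (by lia)
    rw [← Finset.card_image_of_injOn hinj]
    have := card_le_of_pairwise_dvd_sq_sub ((F q A).image (fun p : ℤ × ℤ => 9 * p.2))
      (m := q ^ 2) (by positivity) (L := 18 * V ^ 6) (C := C q A) (by positivity) hC0 ?_ ?_ ?_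
    · push_cast at this
      refine this.trans ?_
      gcongr
      exact ht q hq1 hqQ
    · simp only [Finset.forall_mem_image]
      intro x hx y hy
      have h1 := abs_le.mp (hSB x (Finset.mem_filter.mp hx).1)
      have h2 := abs_le.mp (hSB y (Finset.mem_filter.mp hy).1)
      push_cast
      linarith
    · simp only [Finset.forall_mem_image]
      intro x hx y hy
      have := dvd_sub (Finset.mem_filter.mp hx).2.2 (Finset.mem_filter.mp hy).2.2
      rw [add_sub_add_right_eq_sub] at this
      exact_mod_cast this
    · intro c hc hcq
      simp only [Finset.forall_mem_image]
      intro x hx hcx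
      have hcq' : c ∣ q := (Nat.pow_dvd_pow_iff two_ne_zero).mp hcq
      have h1 := (Finset.mem_filter.mp hx).2.2
      have h2 : (c : ℤ) ^ 2 ∣ (9 * x.2) ^ 2 + 12 * A ^ 3 :=
        (pow_dvd_pow_of_dvd (Int.natCast_dvd_natCast.mpr hcq') 2).trans h1
      have h3 : (c : ℤ) ^ 2 ∣ (2 * (9 * x.2)) ^ 2 := pow_dvd_pow_of_dvd hcx 2
      have h4 : (c : ℤ) ^ 2 ∣ 48 * A ^ 3 := by
        have := dvd_sub (h2.mul_left 4) h3
        rwa [show 4 * ((9 * x.2) ^ 2 + 12 * A ^ 3) - (2 * (9 * x.2)) ^ 2 = 48 * A ^ 3 by ring]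
          at this
      exact Finset.single_le_sum (f := fun c : ℕ => (c : ℝ)) (fun _ _ => by positivity)
        (Finset.mem_filter.mpr ⟨Nat.mem_divisors.mpr ⟨hcq', by lia⟩, h4⟩)
  have hCsum : ∀ q ∈ U, ∑ A ∈ Y, C q A ≤ 150 * V ^ 4 * t * Nat.floorRoot 3 q := by
    intro q hq
    obtain ⟨hq1, hqQ⟩ := Finset.mem_Icc.mp (Finset.mem_filter.mp hq).1
    have h1 : ∑ A ∈ Y, C q A = ∑ c ∈ q.divisors, (c : ℝ) *
        ((intBall (V ^ 4)).filter (fun A => A ≠ 0 ∧ (c : ℤ) ^ 2 ∣ 48 * A ^ 3)).card := by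
      simp only [C, Finset.sum_filter]
      rw [Finset.sum_comm]
      refine Finset.sum_congr rfl fun c _ => ?_
      rw [← Finset.sum_filter, Finset.sum_const, nsmul_eq_mul, mul_comm, hY, Finset.filter_filter]
    rw [h1]
    have h2 : ∀ c ∈ q.divisors, (c : ℝ) *
        ((intBall (V ^ 4)).filter (fun A => A ≠ 0 ∧ (c : ℤ) ^ 2 ∣ 48 * A ^ 3)).card ≤
          150 * V ^ 4 * Nat.floorRoot 3 q := by
      intro c hc
      refine (mul_card_sq_dvd_cube_le (Nat.pos_of_mem_divisors hc) hV4).trans ?_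
      have hle : Nat.floorRoot 3 c ≤ Nat.floorRoot 3 q := by
        refine Nat.le_of_dvd (Nat.pos_of_ne_zero (by simp; lia)) ?_
        rw [← Nat.pow_dvd_iff_dvd_floorRoot]
        exact Nat.floorRoot_pow_dvd.trans (Nat.dvd_of_mem_divisors hc)
      have hle' : (Nat.floorRoot 3 c : ℝ) ≤ Nat.floorRoot 3 q := by exact_mod_cast hle
      gcongr
    refine (Finset.sum_le_sum h2).trans ?_
    rw [Finset.sum_const, nsmul_eq_mul]
    have h3 : (q.divisors.card : ℝ) ≤ t := by
      refine le_trans ?_ (ht q hq1 hqQ)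
      exact_mod_cast Finset.card_le_card
        (Nat.divisors_subset_of_dvd (by positivity) (dvd_pow_self q two_ne_zero))
    calc (q.divisors.card : ℝ) * (150 * V ^ 4 * Nat.floorRoot 3 q)
        ≤ t * (150 * V ^ 4 * Nat.floorRoot 3 q) := by gcongr
      _ = _ := by ring
  have hYc : (Y.card : ℝ) ≤ 3 * V ^ 4 :=
    le_trans (by exact_mod_cast Finset.card_filter_le _ _) (card_intBall_le hV4)
  have hq : ∀ q ∈ U, (((Y.biUnion (F q)).card : ℕ) : ℝ) ≤
      2700 * t ^ 2 * V ^ 10 * (Nat.floorRoot 3 q / (q : ℝ) ^ 2) + 3 * t * V ^ 4 := by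
    intro q hq
    have h1 : (((Y.biUnion (F q)).card : ℕ) : ℝ) ≤ ∑ A ∈ Y, ((F q A).card : ℝ) :=
      (Nat.cast_le.mpr Finset.card_biUnion_le).trans (Nat.cast_sum _ _).le
    refine (h1.trans (Finset.sum_le_sum (hF q hq))).trans ?_
    rw [← Finset.mul_sum, Finset.sum_add_distrib, ← Finset.sum_div, ← Finset.sum_mul,
      Finset.sum_const, nsmul_eq_mul, mul_one]
    calc t * ((∑ A ∈ Y, C q A) * (18 * V ^ 6) / q ^ 2 + Y.card)
        ≤ t * (150 * V ^ 4 * t * Nat.floorRoot 3 q * (18 * V ^ 6) / q ^ 2 + 3 * V ^ 4) := by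
          gcongr
          exact hCsum q hq
      _ = _ := by ring
  have hUc : (U.card : ℝ) ≤ Q := by
    have := Finset.card_filter_le (Finset.Icc 1 Q) (fun q : ℕ => P < q)
    rw [Nat.card_Icc, Nat.add_sub_cancel] at this
    exact_mod_cast this
  have h1 : (S.card : ℝ) ≤ ∑ q ∈ U, (((Y.biUnion (F q)).card : ℕ) : ℝ) :=
    (Nat.cast_le.mpr ((Finset.card_le_card hsub).trans Finset.card_biUnion_le)).trans
      (Nat.cast_sum _ _).le
  refine (h1.trans (Finset.sum_le_sum hq)).trans ?_
  rw [Finset.sum_add_distrib, ← Finset.mul_sum, Finset.sum_const, nsmul_eq_mul]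
  have h2 := sum_floorRoot_div_sq_le hP Q hH
  calc _ ≤ 2700 * t ^ 2 * V ^ 10 * (H ^ 2 / P) + Q * (3 * t * V ^ 4) := by gcongr
    _ = _ := by ring

/-- Two points of `β² ≡ n q²` modulo `M` that are compatible with the same factorization of `M`
are proportional modulo `M`, up to a factor `2`. -/
lemma dvd_two_mul_cross_of_common_factor {n β₀ q₀ β₁ q₁ β₂ q₂ : ℤ} {M g h : ℕ}
    (hn : Squarefree n) (hM : M = g * h) (hM0 : M ≠ 0) (hq₀ : IsCoprime q₀ (M : ℤ))
    (hq₁ : IsCoprime q₁ (M : ℤ)) (h₁ : (M : ℤ) ∣ β₁ ^ 2 - n * q₁ ^ 2)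
    (hg₁ : (g : ℤ) ∣ β₁ * q₀ - β₀ * q₁) (hh₁ : (h : ℤ) ∣ β₁ * q₀ + β₀ * q₁)
    (hg₂ : (g : ℤ) ∣ β₂ * q₀ - β₀ * q₂) (hh₂ : (h : ℤ) ∣ β₂ * q₀ + β₀ * q₂) :
    (M : ℤ) ∣ 2 * (β₁ * q₂ - β₂ * q₁) := by
  have hgM : (g : ℤ) ∣ M := ⟨h, by rw [hM]; push_cast; ring⟩
  have hhM : (h : ℤ) ∣ M := ⟨g, by rw [hM]; push_cast; ring⟩
  have hg : (g : ℤ) ∣ β₁ * q₂ - β₂ * q₁ := by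
    have h2 : (g : ℤ) ∣ q₀ * (β₁ * q₂ - β₂ * q₁) := by
      have := dvd_sub (hg₁.mul_left q₂) (hg₂.mul_left q₁)
      rwa [show q₂ * (β₁ * q₀ - β₀ * q₁) - q₁ * (β₂ * q₀ - β₀ * q₂) =
        q₀ * (β₁ * q₂ - β₂ * q₁) by ring] at this
    exact (hq₀.of_isCoprime_of_dvd_right hgM).symm.dvd_of_dvd_mul_left h2
  have hh : (h : ℤ) ∣ β₁ * q₂ - β₂ * q₁ := by
    have h2 : (h : ℤ) ∣ q₀ * (β₁ * q₂ - β₂ * q₁) := by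
      have := dvd_sub (hh₁.mul_left q₂) (hh₂.mul_left q₁)
      rwa [show q₂ * (β₁ * q₀ + β₀ * q₁) - q₁ * (β₂ * q₀ + β₀ * q₂) =
        q₀ * (β₁ * q₂ - β₂ * q₁) by ring] at this
    exact (hq₀.of_isCoprime_of_dvd_right hhM).symm.dvd_of_dvd_mul_left h2
  have hlcm : ((Nat.lcm g h : ℕ) : ℤ) ∣ β₁ * q₂ - β₂ * q₁ := by
    have := Int.coe_lcm_dvd hg hh
    rwa [Int.lcm_natCast_natCast] at this
  set c := Nat.gcd g h with hc
  have hcg : (c : ℤ) ∣ g := Int.natCast_dvd_natCast.mpr (Nat.gcd_dvd_left _ _)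
  have hch : (c : ℤ) ∣ h := Int.natCast_dvd_natCast.mpr (Nat.gcd_dvd_right _ _)
  have hcM : (c : ℤ) ∣ M := hcg.trans hgM
  have hc2M : (c : ℤ) ^ 2 ∣ M := by
    rw [hM, sq]; push_cast; exact mul_dvd_mul hcg hch
  have hcβ : (c : ℤ) ∣ 2 * β₁ := by
    have h2 := dvd_add (hcg.trans hg₁) (hch.trans hh₁)
    rw [show β₁ * q₀ - β₀ * q₁ + (β₁ * q₀ + β₀ * q₁) = q₀ * (2 * β₁) by ring] at h2
    exact (hq₀.of_isCoprime_of_dvd_right hcM).symm.dvd_of_dvd_mul_left h2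
  have hc4n : (c : ℤ) ^ 2 ∣ 4 * n := by
    have h2 : (c : ℤ) ^ 2 ∣ (2 * β₁) ^ 2 := pow_dvd_pow_of_dvd hcβ 2
    have h3 := dvd_sub h2 ((hc2M.trans h₁).mul_left 4)
    rw [show (2 * β₁) ^ 2 - 4 * (β₁ ^ 2 - n * q₁ ^ 2) = q₁ ^ 2 * (4 * n) by ring] at h3
    exact (hq₁.of_isCoprime_of_dvd_right hcM).symm.pow.dvd_of_dvd_mul_left h3
  have hc2 : c ∣ 2 := by
    have hn0 : n ≠ 0 := hn.ne_zero
    have h2 : c ^ 2 ∣ 2 ^ 2 * n.natAbs := by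
      have := Int.natAbs_dvd_natAbs.mpr hc4n
      simpa [Int.natAbs_mul, Int.natAbs_pow] using this
    have hc0 : c ≠ 0 := by
      rintro h0
      rw [h0] at hcM
      exact hM0 (by simpa using hcM)
    have hsf : Squarefree n.natAbs := Int.squarefree_natAbs.mpr hn
    rw [← Nat.factorization_le_iff_dvd (pow_ne_zero 2 hc0) (by simpa using hn0)] at h2
    rw [← Nat.factorization_le_iff_dvd hc0 two_ne_zero]
    intro p
    have h3 := h2 p
    have h4 := hsf.natFactorization_le_one p
    rw [Nat.factorization_mul (by norm_num) (by simpa using hn0)] at h3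
    simp only [Nat.factorization_pow, Finsupp.smul_apply, smul_eq_mul, Finsupp.add_apply] at h3
    lia
  have hMl : (M : ℤ) ∣ 2 * (Nat.lcm g h : ℕ) := by
    have h2 : M = c * Nat.lcm g h := by rw [hM, hc, Nat.gcd_mul_lcm]
    have : M ∣ 2 * Nat.lcm g h := by
      nth_rewrite 1 [h2]
      exact Nat.mul_dvd_mul_right hc2 _
    exact_mod_cast Int.natCast_dvd_natCast.mpr this
  exact hMl.trans (mul_dvd_mul_left 2 hlcm)

lemma exists_pell_quotient {n N β₁ q₁ β₂ q₂ : ℤ} (hN : N ≠ 0) (h₁ : β₁ ^ 2 - n * q₁ ^ 2 = N)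
    (h₂ : β₂ ^ 2 - n * q₂ ^ 2 = N) (hdvd : N ∣ 2 * (β₁ * q₂ - β₂ * q₁)) :
    ∃ u w : ℤ, 2 * (β₁ * β₂ - n * q₁ * q₂) = N * u ∧ 2 * (β₁ * q₂ - β₂ * q₁) = N * w ∧
      u ^ 2 - n * w ^ 2 = 4 := by
  obtain ⟨w, hw⟩ := hdvd
  have key : (2 * (β₁ * β₂ - n * q₁ * q₂)) ^ 2 - n * (N * w) ^ 2 = 4 * (N * N) := by
    rw [← hw]
    nth_rewrite 1 [← h₁]
    rw [← h₂]
    ring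
  have hsq : N ^ 2 ∣ (2 * (β₁ * β₂ - n * q₁ * q₂)) ^ 2 :=
    ⟨4 + n * w ^ 2, by linear_combination key⟩
  obtain ⟨u, hu⟩ := (Int.pow_dvd_pow_iff two_ne_zero).mp hsq
  refine ⟨u, w, hu, hw, ?_⟩
  rw [hu] at key
  have : N ^ 2 * (u ^ 2 - n * w ^ 2) = N ^ 2 * 4 := by linear_combination key
  exact mul_left_cancel₀ (pow_ne_zero 2 hN) this

/-- Two distinct positive solutions of a Pell equation in the same class differ by a factor at
least `2`. -/
lemma two_mul_le_of_pell {n N β₁ q₁ β₂ q₂ : ℤ} (hN : N ≠ 0) (hn : 0 < n)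
    (h₁ : β₁ ^ 2 - n * q₁ ^ 2 = N) (h₂ : β₂ ^ 2 - n * q₂ ^ 2 = N)
    (hdvd : N ∣ 2 * (β₁ * q₂ - β₂ * q₁)) (hβ₁ : 0 ≤ β₁) (hq₁ : 0 < q₁) (hβ₂ : 0 ≤ β₂)
    (hq₂ : 0 < q₂) (hne : (β₁, q₁) ≠ (β₂, q₂))
    (hle : (β₂ : ℝ) + q₂ * Real.sqrt n ≤ β₁ + q₁ * Real.sqrt n) :
    2 * ((β₂ : ℝ) + q₂ * Real.sqrt n) ≤ β₁ + q₁ * Real.sqrt n := by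
  obtain ⟨u, -, hu, -, -⟩ := exists_pell_quotient hN h₁ h₂ hdvd
  have hn' : (0 : ℝ) < n := by exact_mod_cast hn
  set s := Real.sqrt n with hs
  have hs0 : 0 < s := Real.sqrt_pos.mpr hn'
  have hss : s ^ 2 = n := Real.sq_sqrt hn'.le
  have r₁ := congrArg (fun z : ℤ => (z : ℝ)) h₁
  have r₂ := congrArg (fun z : ℤ => (z : ℝ)) h₂
  have ru := congrArg (fun z : ℤ => (z : ℝ)) hu
  push_cast at r₁ r₂ ru
  have hN' : (N : ℝ) ≠ 0 := by exact_mod_cast hN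
  have b₁ : (0 : ℝ) ≤ β₁ := by exact_mod_cast hβ₁
  have b₂ : (0 : ℝ) ≤ β₂ := by exact_mod_cast hβ₂
  have c₁ : (0 : ℝ) < q₁ := by exact_mod_cast hq₁
  have c₂ : (0 : ℝ) < q₂ := by exact_mod_cast hq₂
  set x : ℝ := β₁ + q₁ * s with hx
  set y : ℝ := β₂ + q₂ * s with hy
  have hx0 : 0 < x := by positivity
  have hy0 : 0 < y := by positivity
  have ex : x * (β₁ - q₁ * s) = N := by rw [hx]; linear_combination r₁ - (q₁ : ℝ) ^ 2 * hss
  have ey : y * (β₂ - q₂ * s) = N := by rw [hy]; linear_combination r₂ - (q₂ : ℝ) ^ 2 * hss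
  have e1 : x * (β₂ - q₂ * s) + y * (β₁ - q₁ * s) = N * u := by
    rw [hx, hy]; linear_combination ru - 2 * (q₁ : ℝ) * q₂ * hss
  have e2 : (N : ℝ) * (x ^ 2 + y ^ 2) = N * (u * (x * y)) := by
    calc (N : ℝ) * (x ^ 2 + y ^ 2) = x ^ 2 * N + y ^ 2 * N := by ring
      _ = x ^ 2 * (y * (β₂ - q₂ * s)) + y ^ 2 * (x * (β₁ - q₁ * s)) := by rw [ex, ey]
      _ = x * y * (x * (β₂ - q₂ * s) + y * (β₁ - q₁ * s)) := by ring
      _ = _ := by rw [e1]; ring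
  have e3 := mul_left_cancel₀ hN' e2
  have hxy : 0 < x * y := by positivity
  rcases le_or_gt u 2 with hu2 | hu3
  · exfalso
    have hu2' : (u : ℝ) ≤ 2 := by exact_mod_cast hu2
    have h3 : (x - y) ^ 2 ≤ 0 := by nlinarith
    have hxy' : x = y := by
      have := pow_eq_zero_iff (two_ne_zero) |>.mp (le_antisymm h3 (sq_nonneg _))
      linarith
    have h4 : (β₁ : ℝ) - q₁ * s = β₂ - q₂ * s := by
      have : x * ((β₁ : ℝ) - q₁ * s) = x * (β₂ - q₂ * s) := by rw [ex, hxy', ey]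
      exact mul_left_cancel₀ hx0.ne' this
    have h5 : (β₁ : ℝ) + q₁ * s = β₂ + q₂ * s := hxy'
    have h6 : (β₁ : ℝ) = β₂ := by linarith
    have h7 : (q₁ : ℝ) = q₂ := by
      have : (q₁ : ℝ) * s = q₂ * s := by linarith
      exact mul_right_cancel₀ hs0.ne' this
    exact hne (Prod.ext (by exact_mod_cast h6) (by exact_mod_cast h7))
  · have hu3' : (3 : ℝ) ≤ u := by exact_mod_cast hu3
    by_contra hcon
    push Not at hcon
    nlinarith [mul_nonneg (sub_nonneg.mpr hle) (sub_nonneg.mpr hcon.le)]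

/-- Bound for the number of bounded solutions of a Pell equation in one class. -/
lemma card_pell_class_le (R : Finset (ℤ × ℤ)) {n N : ℤ} {Z : ℝ} {K : ℕ} (hN : N ≠ 0) (hn : n ≠ 0)
    (hR : ∀ x ∈ R, x.1 ^ 2 - n * x.2 ^ 2 = N ∧ 0 ≤ x.1 ∧ 0 < x.2 ∧ (x.1 : ℝ) ≤ Z ∧
      (n : ℝ) * x.2 ^ 2 ≤ Z ^ 2)
    (hdvd : ∀ x ∈ R, ∀ y ∈ R, N ∣ 2 * (x.1 * y.2 - y.1 * x.2)) (hZ : 0 ≤ Z)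
    (hK : 25 ≤ K) (hZK : 2 * Z < 2 ^ K) : R.card ≤ K := by
  rcases lt_or_gt_of_ne hn with hneg | hpos
  · rcases R.eq_empty_or_nonempty with rfl | ⟨y, hy⟩
    · simp
    have hq : ∀ x ∈ R, ∃ u w : ℤ, 2 * (x.1 * y.1 - n * x.2 * y.2) = N * u ∧
        2 * (x.1 * y.2 - y.1 * x.2) = N * w ∧ u ^ 2 - n * w ^ 2 = 4 := fun x hx =>
      exists_pell_quotient hN (hR x hx).1 (hR y hy).1 (hdvd x hx y hy)
    choose! u w hu hw huw using hq
    have hcard : R.card ≤ (Finset.Icc (-2 : ℤ) 2 ×ˢ Finset.Icc (-2 : ℤ) 2).card := by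
      refine Finset.card_le_card_of_injOn (fun x => (u x, w x)) ?_ ?_
      · intro x hx
        have h1 := huw x hx
        have h2 : u x ^ 2 ≤ 4 := by nlinarith [sq_nonneg (w x)]
        have h3 : w x ^ 2 ≤ 4 := by nlinarith [sq_nonneg (u x), sq_nonneg (w x)]
        simp only [Finset.coe_product, Finset.coe_Icc, Set.mem_prod, Set.mem_Icc]
        refine ⟨⟨?_, ?_⟩, ⟨?_, ?_⟩⟩ <;> nlinarith
      · intro x hx x' hx' h
        simp only [Prod.mk.injEq] at h
        have a1 := hu x hx
        have a2 := hu x' hx'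
        have a3 := hw x hx
        have a4 := hw x' hx'
        rw [h.1] at a1
        rw [h.2] at a3
        have h0 := (hR y hy).1
        have c1 : N * (2 * x.1) = N * (2 * x'.1) := by
          rw [← h0]; linear_combination y.1 * (a1 - a2) - n * y.2 * (a3 - a4)
        have c2 : N * (2 * x.2) = N * (2 * x'.2) := by
          rw [← h0]; linear_combination y.2 * (a1 - a2) - y.1 * (a3 - a4)
        have d1 := mul_left_cancel₀ hN c1
        have d2 := mul_left_cancel₀ hN c2
        exact Prod.ext (by lia) (by lia)
    refine hcard.trans (le_trans ?_ hK)
    simp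
  · have hn' : (1 : ℝ) ≤ n := by exact_mod_cast hpos
    have hs1 : 1 ≤ Real.sqrt n := Real.one_le_sqrt.mpr hn'
    let θ : ℤ × ℤ → ℝ := fun x => (x.1 : ℝ) + x.2 * Real.sqrt n
    have hθ1 : ∀ x ∈ R, 1 ≤ θ x := by
      intro x hx
      obtain ⟨-, h1, h2, -, -⟩ := hR x hx
      have h1' : (0 : ℝ) ≤ x.1 := by exact_mod_cast h1
      have h2' : (1 : ℝ) ≤ x.2 := by exact_mod_cast h2
      have := one_le_mul_of_one_le_of_one_le h2' hs1
      simp only [θ]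
      linarith
    have hθ2 : ∀ x ∈ R, θ x ≤ 2 * Z := by
      intro x hx
      obtain ⟨-, -, h2, h3, h4⟩ := hR x hx
      have h5 : ((x.2 : ℝ) * Real.sqrt n) ^ 2 ≤ Z ^ 2 := by
        rw [mul_pow, Real.sq_sqrt (by linarith)]; linarith
      have := (abs_le_of_sq_le_sq' h5 hZ).2
      simp only [θ]
      linarith
    have hsep : ∀ x ∈ R, ∀ y ∈ R, x ≠ y → θ y ≤ θ x →
        Nat.log 2 ⌊θ y⌋₊ < Nat.log 2 ⌊θ x⌋₊ := by
      intro x hx y hy hxy hle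
      obtain ⟨e1, p1, p2, -, -⟩ := hR x hx
      obtain ⟨e2, p3, p4, -, -⟩ := hR y hy
      have h2 : 2 * θ y ≤ θ x :=
        two_mul_le_of_pell hN hpos e1 e2 (hdvd x hx y hy) p1 p2 p3 p4 hxy hle
      have hy1 : 1 ≤ ⌊θ y⌋₊ := Nat.le_floor (by simpa using hθ1 y hy)
      have h3 : 2 * ⌊θ y⌋₊ ≤ ⌊θ x⌋₊ := by
        refine Nat.le_floor ?_
        push_cast
        have := Nat.floor_le (by linarith [hθ1 y hy] : 0 ≤ θ y)
        linarith
      have h4 := Nat.log_mono_right (b := 2) h3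
      rw [mul_comm, Nat.log_mul_base (by norm_num) (by lia)] at h4
      lia
    have hcard : R.card ≤ (Finset.range K).card := by
      refine Finset.card_le_card_of_injOn (fun x => Nat.log 2 ⌊θ x⌋₊) ?_ ?_
      · intro x hx
        simp only [Finset.coe_range, Set.mem_Iio]
        refine Nat.log_lt_of_lt_pow ?_ ?_
        · have : 1 ≤ ⌊θ x⌋₊ := Nat.le_floor (by simpa using hθ1 x hx)
          lia
        · rw [Nat.floor_lt (by linarith [hθ1 x hx])]
          push_cast
          linarith [hθ2 x hx]
      · intro x hx y hy hxy
        by_contra hne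
        rcases le_total (θ y) (θ x) with h | h
        · exact (hsep x hx y hy hne h).ne hxy.symm
        · exact (hsep y hy x hx (Ne.symm hne) h).ne hxy
    simpa using hcard

/-- Bound for the number of bounded primitive solutions of a Pell equation. -/
lemma card_pell_primitive_le (R : Finset (ℤ × ℤ)) {n N : ℤ} {Z : ℝ} {K : ℕ} (hN : N ≠ 0)
    (hn : Squarefree n)
    (hR : ∀ x ∈ R, x.1 ^ 2 - n * x.2 ^ 2 = N ∧ 0 ≤ x.1 ∧ 0 < x.2 ∧ (x.1 : ℝ) ≤ Z ∧
      (n : ℝ) * x.2 ^ 2 ≤ Z ^ 2)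
    (hcop : ∀ x ∈ R, IsCoprime x.1 x.2) (hZ : 0 ≤ Z)
    (hK : 25 ≤ K) (hZK : 2 * Z < 2 ^ K) : R.card ≤ N.natAbs.divisors.card * K := by
  rcases R.eq_empty_or_nonempty with rfl | ⟨x₀, hx₀⟩
  · simp
  set M := N.natAbs with hM
  have hM0 : M ≠ 0 := by simpa [hM] using hN
  have hMN : (M : ℤ) ∣ N := by rw [hM]; exact Int.natAbs_dvd.mpr dvd_rfl
  have hNM : N ∣ (M : ℤ) := by rw [hM]; exact Int.dvd_natAbs.mpr dvd_rfl
  have hqM : ∀ x ∈ R, IsCoprime x.2 (M : ℤ) := by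
    intro x hx
    have h1 : IsCoprime x.2 N := by
      rw [← (hR x hx).1, show x.1 ^ 2 - n * x.2 ^ 2 = x.1 ^ 2 + x.2 * (-(n * x.2)) by ring]
      exact (IsCoprime.add_mul_left_right_iff).mpr (hcop x hx).symm.pow_right
    exact h1.of_isCoprime_of_dvd_right hMN
  have hmap : ∀ x ∈ R, Int.gcd M (x.1 * x₀.2 - x₀.1 * x.2) ∈ M.divisors := by
    intro x _
    rw [Nat.mem_divisors]
    exact ⟨Int.natCast_dvd_natCast.mp (Int.gcd_dvd_left _ _), hM0⟩
  rw [mul_comm]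
  refine Finset.card_le_mul_card_image_of_maps_to hmap K (fun g hg => ?_)
  obtain ⟨h, hgh⟩ := Nat.dvd_of_mem_divisors hg
  have hgpos : 0 < g := Nat.pos_of_mem_divisors hg
  have hboth : ∀ x ∈ R.filter (fun x => Int.gcd M (x.1 * x₀.2 - x₀.1 * x.2) = g),
      x ∈ R ∧ (g : ℤ) ∣ x.1 * x₀.2 - x₀.1 * x.2 ∧ (h : ℤ) ∣ x.1 * x₀.2 + x₀.1 * x.2 := by
    intro x hx
    rw [Finset.mem_filter] at hx
    refine ⟨hx.1, by rw [← hx.2]; exact Int.gcd_dvd_right _ _, ?_⟩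
    refine dvd_of_gcd_eq_of_dvd_mul hx.2 hgh hgpos (hMN.trans ?_)
    refine ⟨x₀.2 ^ 2 - x.2 ^ 2, ?_⟩
    have e1 := (hR x hx.1).1
    have e2 := (hR x₀ hx₀).1
    linear_combination x₀.2 ^ 2 * e1 - x.2 ^ 2 * e2
  refine card_pell_class_le _ hN hn.ne_zero (fun x hx => hR x (hboth x hx).1) ?_ hZ hK hZK
  intro x hx y hy
  obtain ⟨hxR, hxg, hxh⟩ := hboth x hx
  obtain ⟨hyR, hyg, hyh⟩ := hboth y hy
  exact hNM.trans (dvd_two_mul_cross_of_common_factor hn hgh hM0 (hqM x₀ hx₀) (hqM x hxR)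
    (hMN.trans (by rw [(hR x hxR).1])) hxg hxh hyg hyh)

/-- Bound for the number of bounded solutions of a Pell equation. -/
lemma card_pell_le (R : Finset (ℤ × ℤ)) {n N : ℤ} {Z : ℝ} {K : ℕ} (hN : N ≠ 0)
    (hn : Squarefree n)
    (hR : ∀ x ∈ R, x.1 ^ 2 - n * x.2 ^ 2 = N ∧ 0 ≤ x.1 ∧ 0 < x.2 ∧ (x.1 : ℝ) ≤ Z ∧
      (n : ℝ) * x.2 ^ 2 ≤ Z ^ 2) (hZ : 0 ≤ Z)
    (hK : 25 ≤ K) (hZK : 2 * Z < 2 ^ K) : R.card ≤ N.natAbs.divisors.card ^ 2 * K := by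
  have hN0 : N.natAbs ≠ 0 := by simpa using hN
  have hg2 : ∀ x ∈ R, ((Int.gcd x.1 x.2 : ℕ) : ℤ) ^ 2 ∣ N := by
    intro x hx
    rw [← (hR x hx).1]
    exact dvd_sub (pow_dvd_pow_of_dvd (Int.gcd_dvd_left _ _) 2)
      ((pow_dvd_pow_of_dvd (Int.gcd_dvd_right _ _) 2).mul_left n)
  have hmap : ∀ x ∈ R, Int.gcd x.1 x.2 ∈ N.natAbs.divisors := by
    intro x hx
    rw [Nat.mem_divisors]
    exact ⟨Int.natCast_dvd.mp ((dvd_pow_self _ two_ne_zero).trans (hg2 x hx)), hN0⟩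
  rw [show N.natAbs.divisors.card ^ 2 * K = N.natAbs.divisors.card * K * N.natAbs.divisors.card by
    ring]
  refine Finset.card_le_mul_card_image_of_maps_to hmap _ (fun g hg => ?_)
  set T := R.filter (fun x => Int.gcd x.1 x.2 = g) with hT
  rcases T.eq_empty_or_nonempty with h0 | ⟨x₀, hx₀⟩
  · rw [h0]; simp
  have hgpos : 0 < g := Nat.pos_of_mem_divisors hg
  have hg0 : (g : ℤ) ≠ 0 := by exact_mod_cast hgpos.ne'
  obtain ⟨N', hN'⟩ : (g : ℤ) ^ 2 ∣ N := by
    have := hg2 x₀ (Finset.mem_filter.mp hx₀).1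
    rwa [(Finset.mem_filter.mp hx₀).2] at this
  have hN'0 : N' ≠ 0 := by rintro rfl; simp at hN'; exact hN hN'
  have hmul : ∀ x ∈ T, x.1 = g * (x.1 / g) ∧ x.2 = g * (x.2 / g) := by
    intro x hx
    have h1 := (Finset.mem_filter.mp hx).2
    refine ⟨(Int.mul_ediv_cancel' ?_).symm, (Int.mul_ediv_cancel' ?_).symm⟩
    · rw [← h1]; exact Int.gcd_dvd_left _ _
    · rw [← h1]; exact Int.gcd_dvd_right _ _
  have hinj : Set.InjOn (fun x : ℤ × ℤ => (x.1 / (g : ℤ), x.2 / (g : ℤ))) (T : Set (ℤ × ℤ)) := by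
    intro x hx y hy hxy
    simp only [Prod.mk.injEq] at hxy
    exact Prod.ext (by rw [(hmul x hx).1, (hmul y hy).1, hxy.1])
      (by rw [(hmul x hx).2, (hmul y hy).2, hxy.2])
  rw [← Finset.card_image_of_injOn hinj]
  have hle := card_pell_primitive_le (T.image (fun x : ℤ × ℤ => (x.1 / (g : ℤ), x.2 / (g : ℤ))))
    hN'0 hn (Z := Z) (K := K) ?_ ?_ hZ hK hZK
  · refine hle.trans (Nat.mul_le_mul_right K (Finset.card_le_card ?_))
    refine Nat.divisors_subset_of_dvd hN0 (Int.natAbs_dvd_natAbs.mpr ?_)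
    exact ⟨(g : ℤ) ^ 2, by rw [hN']; ring⟩
  · simp only [Finset.forall_mem_image]
    intro x hx
    obtain ⟨e1, p1, p2, p3, p4⟩ := hR x (Finset.mem_filter.mp hx).1
    obtain ⟨m1, m2⟩ := hmul x hx
    set β := x.1 / (g : ℤ)
    set q := x.2 / (g : ℤ)
    have hgz : (0 : ℤ) < g := by exact_mod_cast hgpos
    have hg1 : (1 : ℝ) ≤ g := by exact_mod_cast hgpos
    rw [m1] at p1 p3
    rw [m2] at p2 p4
    have hβ0 : 0 ≤ β := nonneg_of_mul_nonneg_right p1 hgz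
    have hq0 : 0 < q := (mul_pos_iff_of_pos_left hgz).mp p2
    have hβr : (0 : ℝ) ≤ β := by exact_mod_cast hβ0
    push_cast at p3 p4
    refine ⟨?_, hβ0, hq0, ?_, ?_⟩
    · rw [m1, m2, hN'] at e1
      have : (g : ℤ) ^ 2 * (β ^ 2 - n * q ^ 2) = g ^ 2 * N' := by rw [← e1]; ring
      exact mul_left_cancel₀ (pow_ne_zero 2 hg0) this
    · nlinarith
    · rcases le_or_gt ((n : ℝ) * q ^ 2) 0 with h | h
      · exact h.trans (sq_nonneg Z)
      · have h1 : (1 : ℝ) ≤ (g : ℝ) ^ 2 := one_le_pow₀ hg1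
        nlinarith
  · simp only [Finset.forall_mem_image]
    intro x hx
    obtain ⟨m1, m2⟩ := hmul x hx
    have h1 := (Finset.mem_filter.mp hx).2
    rw [Int.isCoprime_iff_gcd_eq_one, ← h1]
    refine Int.gcd_ediv_gcd_ediv_gcd ?_
    rw [h1]; exact hgpos

lemma card_large_sq_dvd_of_nonneg_le (S : Finset (ℤ × ℤ)) {V t : ℝ} {K : ℕ} (hV : 1 ≤ V)
    (ht : ∀ A : ℤ, A ≠ 0 → |(A : ℝ)| ≤ V ^ 4 → ((-12 * A ^ 3).natAbs.divisors.card : ℝ) ≤ t)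
    (hK : 25 ≤ K) (hVK : 20 * V ^ 6 < 2 ^ K)
    (hSA : ∀ p ∈ S, |(p.1 : ℝ)| ≤ V ^ 4) (hSB : ∀ p ∈ S, |(p.2 : ℝ)| ≤ V ^ 6)
    (hB : ∀ p ∈ S, 0 ≤ p.2)
    (hS : ∀ p ∈ S, p.1 ≠ 0 ∧ ∃ n q : ℤ, Squarefree n ∧ 0 < q ∧ V ^ 4 < q ∧
      (9 * p.2) ^ 2 + 12 * p.1 ^ 3 = n * q ^ 2) :
    (S.card : ℝ) ≤ 837 * V ^ 8 * (t ^ 2 * K) := by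
  choose! hA0 n q hn hq hVq he using hS
  have hV4 : 1 ≤ V ^ 4 := one_le_pow₀ hV
  have habs : ∀ p ∈ S, |((n p * q p ^ 2 : ℤ) : ℝ)| ≤ 93 * V ^ 12 := by
    intro p hp
    rw [← he p hp]
    push_cast
    have h1 : |(p.1 : ℝ) ^ 3| ≤ V ^ 12 := by
      rw [abs_pow]
      calc |(p.1 : ℝ)| ^ 3 ≤ (V ^ 4) ^ 3 := by gcongr; exact hSA p hp
        _ = V ^ 12 := by ring
    have h2 : (p.2 : ℝ) ^ 2 ≤ V ^ 12 := by
      rw [← sq_abs]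
      calc |(p.2 : ℝ)| ^ 2 ≤ (V ^ 6) ^ 2 := by gcongr; exact hSB p hp
        _ = V ^ 12 := by ring
    have h3 := abs_le.mp h1
    have h4 := sq_nonneg (p.2 : ℝ)
    rw [abs_le]
    constructor <;> nlinarith
  have hnU : ∀ p ∈ S, |(n p : ℝ)| ≤ 93 * V ^ 4 := by
    intro p hp
    have h1 := habs p hp
    push_cast at h1
    rw [abs_mul, abs_of_nonneg (sq_nonneg (q p : ℝ))] at h1
    have h2 : V ^ 8 ≤ (q p : ℝ) ^ 2 := by
      calc V ^ 8 = (V ^ 4) ^ 2 := by ring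
        _ ≤ _ := by gcongr; exact (hVq p hp).le
    have h3 : |(n p : ℝ)| * V ^ 8 ≤ 93 * V ^ 4 * V ^ 8 := by
      calc |(n p : ℝ)| * V ^ 8 ≤ |(n p : ℝ)| * (q p : ℝ) ^ 2 := by gcongr
        _ ≤ 93 * V ^ 12 := h1
        _ = _ := by ring
    exact le_of_mul_le_mul_right h3 (by positivity)
  have h1 := card_le_card_mul_of_fiber_le S (intBall (V ^ 4) ×ˢ intBall (93 * V ^ 4))
    (fun p => (p.1, n p)) (c := t ^ 2 * K)
    (fun p hp => Finset.mem_product.mpr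
      ⟨mem_intBall.mpr (hSA p hp), mem_intBall.mpr (hnU p hp)⟩) ?_
  · have h2 := card_intBall_le hV4
    have h3 := card_intBall_le (by linarith : 1 ≤ 93 * V ^ 4)
    rw [Finset.card_product, Nat.cast_mul] at h1
    calc (S.card : ℝ) ≤ _ := h1
      _ ≤ 3 * V ^ 4 * (3 * (93 * V ^ 4)) * (t ^ 2 * K) := by gcongr
      _ = _ := by ring
  rintro ⟨A, m⟩ _
  set F := S.filter (fun p => (p.1, n p) = (A, m)) with hF
  have hmem : ∀ p ∈ F, p ∈ S ∧ p.1 = A ∧ n p = m := by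
    intro p hp
    rw [hF, Finset.mem_filter, Prod.mk.injEq] at hp
    exact hp
  rcases F.eq_empty_or_nonempty with h0 | ⟨p₀, hp₀⟩
  · rw [h0, Finset.card_empty, Nat.cast_zero]
    positivity
  obtain ⟨h₀S, h₀A, h₀n⟩ := hmem p₀ hp₀
  have hAne : A ≠ 0 := h₀A ▸ hA0 p₀ h₀S
  have hinj : Set.InjOn (fun p : ℤ × ℤ => (9 * p.2, q p)) (F : Set (ℤ × ℤ)) := by
    intro x hx y hy hxy
    simp only [Prod.mk.injEq] at hxy
    exact Prod.ext ((hmem x hx).2.1.trans (hmem y hy).2.1.symm) (by lia)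
  rw [← Finset.card_image_of_injOn hinj]
  have h2 := card_pell_le (F.image (fun p : ℤ × ℤ => (9 * p.2, q p))) (n := m)
    (N := -12 * A ^ 3) (Z := 10 * V ^ 6) (K := K) (by simpa using hAne) (h₀n ▸ hn p₀ h₀S) ?_
    (by positivity) hK (by linarith)
  · calc ((F.image (fun p : ℤ × ℤ => (9 * p.2, q p))).card : ℝ)
        ≤ ((-12 * A ^ 3).natAbs.divisors.card : ℝ) ^ 2 * K := by exact_mod_cast h2
      _ ≤ t ^ 2 * K := by
        gcongr
        exact ht A hAne (h₀A ▸ hSA p₀ h₀S)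
  simp only [Finset.forall_mem_image]
  intro p hp
  obtain ⟨hpS, hpA, hpn⟩ := hmem p hp
  have e := he p hpS
  have h3 := abs_le.mp (habs p hpS)
  rw [hpA, hpn] at e
  rw [hpn] at h3
  push_cast at h3
  refine ⟨by linear_combination e, by linarith [hB p hpS], hq p hpS, ?_, ?_⟩
  · have h4 := (abs_le.mp (hSB p hpS)).2
    have : (0 : ℝ) ≤ V ^ 6 := by positivity
    push_cast
    linarith
  · have : (0 : ℝ) ≤ V ^ 12 := by positivity
    calc (m : ℝ) * q p ^ 2 ≤ 93 * V ^ 12 := h3.2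
      _ ≤ 100 * V ^ 12 := by linarith
      _ = _ := by ring

/-- There are few pairs `(A, B)` of discriminant divisible by the square of a large integer. -/
lemma card_large_sq_dvd_le (S : Finset (ℤ × ℤ)) {V t : ℝ} {K : ℕ} (hV : 1 ≤ V)
    (ht : ∀ A : ℤ, A ≠ 0 → |(A : ℝ)| ≤ V ^ 4 → ((-12 * A ^ 3).natAbs.divisors.card : ℝ) ≤ t)
    (hK : 25 ≤ K) (hVK : 20 * V ^ 6 < 2 ^ K)
    (hSA : ∀ p ∈ S, |(p.1 : ℝ)| ≤ V ^ 4) (hSB : ∀ p ∈ S, |(p.2 : ℝ)| ≤ V ^ 6)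
    (hS : ∀ p ∈ S, p.1 ≠ 0 ∧ ∃ n q : ℤ, Squarefree n ∧ 0 < q ∧ V ^ 4 < q ∧
      (9 * p.2) ^ 2 + 12 * p.1 ^ 3 = n * q ^ 2) :
    (S.card : ℝ) ≤ 1674 * V ^ 8 * (t ^ 2 * K) := by
  have hpos := card_large_sq_dvd_of_nonneg_le (S.filter (fun p => 0 ≤ p.2)) hV ht hK hVK
    (fun p hp => hSA p (Finset.mem_filter.mp hp).1) (fun p hp => hSB p (Finset.mem_filter.mp hp).1)
    (fun p hp => (Finset.mem_filter.mp hp).2) (fun p hp => hS p (Finset.mem_filter.mp hp).1)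
  have hinj : Set.InjOn (fun p : ℤ × ℤ => (p.1, -p.2))
      (S.filter (fun p => ¬0 ≤ p.2) : Set (ℤ × ℤ)) := by
    intro x _ y _ hxy
    simpa [Prod.ext_iff] using hxy
  have hneg := card_large_sq_dvd_of_nonneg_le
    ((S.filter (fun p => ¬0 ≤ p.2)).image (fun p : ℤ × ℤ => (p.1, -p.2))) hV ht hK hVK
    ?_ ?_ ?_ ?_
  · rw [Finset.card_image_of_injOn hinj] at hneg
    rw [← Finset.card_filter_add_card_filter_not (fun p : ℤ × ℤ => 0 ≤ p.2)]
    push_cast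
    linarith
  all_goals
    simp only [Finset.forall_mem_image, Finset.mem_filter]
    rintro p ⟨hp, h0⟩
  · exact hSA p hp
  · simpa using hSB p hp
  · lia
  · simpa using hS p hp

/-- Every nonzero integer is a squarefree integer times a square, and the square part is a
multiple of every integer whose square divides. -/
lemma exists_squarefree_mul_sq {D : ℤ} (hD : D ≠ 0) :
    ∃ n q : ℤ, Squarefree n ∧ 0 < q ∧ D = n * q ^ 2 ∧ ∀ g : ℕ, (g : ℤ) ^ 2 ∣ D → (g : ℤ) ≤ q := by
  obtain ⟨a, b, ha, hb, hab, hsq⟩ := Nat.sq_mul_squarefree_of_pos (Int.natAbs_pos.mpr hD)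
  refine ⟨D.sign * a, b, ?_, by exact_mod_cast hb, ?_, ?_⟩
  · rw [← Int.squarefree_natAbs, Int.natAbs_mul, Int.natAbs_sign_of_ne_zero hD, one_mul,
      Int.natAbs_natCast]
    exact hsq
  · calc D = D.sign * D.natAbs := (Int.sign_mul_natAbs D).symm
      _ = _ := by rw [← hab]; push_cast; ring
  · intro g hg
    have h1 : g ^ 2 ∣ b ^ 2 * a := by
      rw [hab]
      have := Int.natAbs_dvd_natAbs.mpr hg
      simpa [Int.natAbs_pow] using this
    have hg0 : g ≠ 0 := by
      rintro rfl
      simp at h1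
      lia
    have h2 : g ∣ b := by
      rw [← Nat.factorization_le_iff_dvd hg0 hb.ne']
      intro p
      have h3 := (Nat.factorization_le_iff_dvd (pow_ne_zero 2 hg0) (by positivity)).mpr h1 p
      rw [Nat.factorization_mul (by positivity) ha.ne'] at h3
      have h4 := hsq.natFactorization_le_one p
      simp at h3
      lia
    exact_mod_cast Nat.le_of_dvd hb h2

lemma sum_one_div_le_one_add_log {n : ℕ} {R : ℝ} (hR : 1 ≤ R) (hn : (n : ℝ) ≤ R) :
    ∑ k ∈ Finset.Icc 1 n, (1 : ℝ) / k ≤ 1 + Real.log R := by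
  rcases Nat.eq_zero_or_pos n with rfl | h0
  · simpa using add_nonneg zero_le_one (Real.log_nonneg hR)
  have h1 : ∑ k ∈ Finset.Icc 1 n, (1 : ℝ) / k = (harmonic n : ℝ) := by
    rw [harmonic_eq_sum_Icc]
    push_cast
    simp
  rw [h1]
  exact (harmonic_le_one_add_log n).trans
    (by gcongr)

lemma one_add_mul_log_le {a c R : ℝ} (ha : 0 < a) (hc : 0 ≤ c) (hR : 1 ≤ R) :
    1 + c * Real.log R ≤ (1 + c / a) * R ^ a := by
  have h1 := Real.log_le_rpow_div (by linarith : 0 ≤ R) ha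
  have h2 : 1 ≤ R ^ a := Real.one_le_rpow hR ha.le
  calc 1 + c * Real.log R ≤ R ^ a + c * (R ^ a / a) := by gcongr
    _ = _ := by ring

/-- Version of `card_curves_with_small_point_le` with the subpolynomial factors made explicit. -/
lemma exists_card_curves_with_small_point_le {η : ℝ} (hη : 0 < η) :
    ∃ C : ℝ, 0 < C ∧ ∀ (S : Finset (ℤ × ℤ)) (V m : ℝ), 1 ≤ V → 1 ≤ m →
      (∀ p ∈ S, |(p.1 : ℝ)| ≤ V ^ 4) → (∀ p ∈ S, |(p.2 : ℝ)| ≤ V ^ 6) →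
      (∀ p ∈ S, ∃ a b : ℤ, ∃ d : ℕ, 0 < d ∧ IsCoprime a d ∧ IsCoprime b d ∧
        |(a : ℝ)| ≤ m ^ 2 ∧ V ^ 2 * d ^ 2 ≤ m ^ 2 ∧
        b ^ 2 = a ^ 3 + p.1 * a * d ^ 4 + p.2 * d ^ 6) →
      (S.card : ℝ) ≤ C * m ^ η * (V ^ 9 + V ^ 5 * m + V ^ 3 * m ^ 2 + m ^ 3 / V) := by
  set a := η / 3 with ha
  have ha0 : 0 < a := by positivity
  obtain ⟨C₁, hC₁, hτ⟩ := exists_card_divisors_le_rpow (by positivity : 0 < a / 4)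
  refine ⟨100 * C₁ * (1 + 2 / a) ^ 2, by positivity, fun S V m hV hm hSA hSB hS => ?_⟩
  have hm0 : 0 < m := by linarith
  have hma : 1 ≤ m ^ a := Real.one_le_rpow hm ha0.le
  have h1 := card_curves_with_small_point_le S (t := C₁ * m ^ a) (H := (1 + 2 / a) * m ^ a)
    hV hm (by positivity) ?_ ?_ ?_ hSA hSB hS
  · calc (S.card : ℝ) ≤ _ := h1
      _ = 100 * C₁ * (1 + 2 / a) ^ 2 * (m ^ a) ^ 3 *
          (V ^ 9 + V ^ 5 * m + V ^ 3 * m ^ 2 + m ^ 3 / V) := by ring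
      _ = _ := by
        rw [← Real.rpow_natCast (m ^ a) 3, ← Real.rpow_mul hm0.le, ha]
        congr 3
        push_cast
        ring
  · intro d hd hdm
    refine (hτ _ (pow_ne_zero 4 hd.ne')).trans ?_
    push_cast
    rw [← Real.rpow_natCast, ← Real.rpow_mul (by positivity)]
    gcongr
    calc (d : ℝ) ^ (((4 : ℕ) : ℝ) * (a / 4)) = (d : ℝ) ^ a := by congr 1; push_cast; ring
      _ ≤ m ^ a := by gcongr
  · have : 0 ≤ 2 / a := by positivity
    nlinarith
  · intro n hn
    refine (sum_one_div_le_one_add_log (one_le_pow₀ hm) hn).trans ?_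
    rw [Real.log_pow]
    exact one_add_mul_log_le ha0 (by norm_num) hm

lemma exists_two_pow_gt {V : ℝ} (hV : 1 ≤ V) :
    ∃ K : ℕ, 25 ≤ K ∧ 20 * V ^ 6 < 2 ^ K ∧ (K : ℝ) ≤ 31 * (1 + 1 * Real.log V) := by
  have hL := Real.log_nonneg hV
  refine ⟨30 + ⌈12 * Real.log V⌉₊, by lia, ?_, ?_⟩
  · have h1 : V ^ 6 ≤ 2 ^ ⌈12 * Real.log V⌉₊ := by
      calc V ^ 6 = Real.exp (Real.log V * 6) := by
            rw [Real.exp_mul, Real.exp_log (by linarith)]; norm_num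
        _ ≤ Real.exp (⌈12 * Real.log V⌉₊ * (1 / 2)) := by
          refine Real.exp_le_exp.mpr ?_
          linarith [Nat.le_ceil (12 * Real.log V)]
        _ = Real.exp (1 / 2) ^ ⌈12 * Real.log V⌉₊ := by rw [Real.exp_nat_mul]
        _ ≤ _ := by
          gcongr
          have h2 : Real.exp (1 / 2) ^ 2 = Real.exp 1 := by
            rw [← Real.exp_nat_mul]; norm_num
          nlinarith [Real.exp_one_lt_d9, Real.exp_pos (1 / 2)]
    have h3 : 0 < V ^ 6 := by positivity
    rw [pow_add]
    nlinarith
  · have := Nat.ceil_lt_add_one (by positivity : 0 ≤ 12 * Real.log V)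
    push_cast
    linarith

/-- Few pairs `(A, B)` have a discriminant divisible by the square of an integer exceeding `P`. -/
lemma exists_card_sq_dvd_disc_le {η : ℝ} (hη : 0 < η) :
    ∃ C : ℝ, 0 < C ∧ ∀ (S : Finset (ℤ × ℤ)) (V P : ℝ), 1 ≤ V → 0 < P →
      (∀ p ∈ S, |(p.1 : ℝ)| ≤ V ^ 4) → (∀ p ∈ S, |(p.2 : ℝ)| ≤ V ^ 6) →
      (∀ p ∈ S, p.1 ≠ 0 ∧ 4 * p.1 ^ 3 + 27 * p.2 ^ 2 ≠ 0 ∧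
        ∃ g : ℕ, P < g ∧ (g : ℤ) ^ 2 ∣ 4 * p.1 ^ 3 + 27 * p.2 ^ 2) →
      (S.card : ℝ) ≤ C * V ^ η * (V ^ 10 / P + V ^ 8) := by
  set a := η / 4 with ha
  have ha0 : 0 < a := by positivity
  obtain ⟨C₁, hC₁, hτ⟩ := exists_card_divisors_le_rpow (by positivity : 0 < a / 12)
  set c := C₁ * (12 : ℝ) ^ (a / 12) with hc
  set h := 1 + 4 / a with hh
  set k := 31 * (1 + 1 / a) with hk
  have hc0 : 0 < c := by positivity
  have hh0 : 0 < h := by positivity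
  have hk0 : 0 < k := by positivity
  refine ⟨2700 * c ^ 2 * h ^ 2 + 3 * c + 1674 * c ^ 2 * k, by positivity,
    fun S V P hV hP hSA hSB hS => ?_⟩
  have hV0 : 0 < V := by linarith
  have hV4 : 1 ≤ V ^ 4 := one_le_pow₀ hV
  set u := V ^ a with hu
  have hu1 : 1 ≤ u := Real.one_le_rpow hV ha0.le
  have hu4 : u ^ 4 = V ^ η := by
    rw [hu, ← Real.rpow_natCast, ← Real.rpow_mul hV0.le, ha]
    congr 1
    push_cast
    ring
  have hV12 : (12 * V ^ 12) ^ (a / 12) = (12 : ℝ) ^ (a / 12) * u := by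
    rw [Real.mul_rpow (by norm_num) (by positivity), ← Real.rpow_natCast, ← Real.rpow_mul hV0.le,
      hu]
    congr 2
    push_cast
    ring
  have hdiv : ∀ n : ℕ, n ≠ 0 → (n : ℝ) ≤ 12 * V ^ 12 → (n.divisors.card : ℝ) ≤ c * u := by
    intro n hn hle
    calc (n.divisors.card : ℝ) ≤ C₁ * (n : ℝ) ^ (a / 12) := hτ n hn
      _ ≤ C₁ * (12 * V ^ 12) ^ (a / 12) := by gcongr
      _ = c * u := by rw [hV12, hc]; ring
  obtain ⟨K, hK25, hK2, hK⟩ := exists_two_pow_gt hV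
  have hKu : (K : ℝ) ≤ k * u := by
    refine hK.trans ?_
    have := one_add_mul_log_le ha0 zero_le_one hV
    rw [hk, mul_assoc]
    gcongr
  have hQ : ((⌊V ^ 4⌋₊ : ℕ) : ℝ) ≤ V ^ 4 := Nat.floor_le (by positivity)
  have hdecomp : ∀ p ∈ S, ∃ n q : ℤ, Squarefree n ∧ 0 < q ∧
      (9 * p.2) ^ 2 + 12 * p.1 ^ 3 = n * q ^ 2 ∧ P < q := by
    intro p hp
    obtain ⟨-, hΔ, g, hPg, hg⟩ := hS p hp
    have e : (9 * p.2) ^ 2 + 12 * p.1 ^ 3 = (4 * p.1 ^ 3 + 27 * p.2 ^ 2) * 3 := by ring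
    obtain ⟨n, q, hn, hq, hD, hmax⟩ :=
      exists_squarefree_mul_sq (D := (9 * p.2) ^ 2 + 12 * p.1 ^ 3)
        (by rw [e]; exact mul_ne_zero hΔ (by norm_num))
    refine ⟨n, q, hn, hq, hD, hPg.trans_le ?_⟩
    exact_mod_cast hmax g (by rw [e]; exact hg.mul_right 3)
  choose! n q hn hq he hPq using hdecomp
  have hmed := card_medium_sq_dvd_le (S.filter (fun p => (q p : ℝ) ≤ V ^ 4)) (V := V) (P := P)
    (t := c * u) (H := h * u) (Q := ⌊V ^ 4⌋₊) hV hP (by positivity) ?_ ?_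
    (fun p hp => hSA p (Finset.mem_filter.mp hp).1)
    (fun p hp => hSB p (Finset.mem_filter.mp hp).1) ?_
  · have hlarge := card_large_sq_dvd_le (S.filter (fun p => ¬(q p : ℝ) ≤ V ^ 4)) (V := V)
      (t := c * u) (K := K) hV ?_ hK25 hK2
      (fun p hp => hSA p (Finset.mem_filter.mp hp).1)
      (fun p hp => hSB p (Finset.mem_filter.mp hp).1) ?_
    · rw [← Finset.card_filter_add_card_filter_not (fun p : ℤ × ℤ => (q p : ℝ) ≤ V ^ 4), ← hu4]
      push_cast
      have hu14 : u ≤ u ^ 4 := le_self_pow₀ hu1 (by norm_num)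
      have hu34 : u ^ 3 ≤ u ^ 4 := pow_le_pow_right₀ hu1 (by norm_num)
      calc _ ≤ 2700 * (c * u) ^ 2 * (h * u) ^ 2 * V ^ 10 / P + 3 * (c * u) * V ^ 4 * V ^ 4 +
            1674 * V ^ 8 * ((c * u) ^ 2 * (k * u)) := by
            refine add_le_add (hmed.trans ?_) (hlarge.trans ?_)
            · gcongr
            · gcongr
        _ = 2700 * c ^ 2 * h ^ 2 * u ^ 4 * (V ^ 10 / P) + 3 * c * u * V ^ 8 +
            1674 * c ^ 2 * k * u ^ 3 * V ^ 8 := by ring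
        _ ≤ 2700 * c ^ 2 * h ^ 2 * u ^ 4 * (V ^ 10 / P + V ^ 8) +
            3 * c * u ^ 4 * (V ^ 10 / P + V ^ 8) +
            1674 * c ^ 2 * k * u ^ 4 * (V ^ 10 / P + V ^ 8) := by
          have h8 : V ^ 8 ≤ V ^ 10 / P + V ^ 8 := le_add_of_nonneg_left (by positivity)
          have h10 : V ^ 10 / P ≤ V ^ 10 / P + V ^ 8 := le_add_of_nonneg_right (by positivity)
          gcongr
        _ = _ := by ring
    · intro A hA hAV
      refine hdiv _ (by simpa using hA) ?_
      rw [Nat.cast_natAbs]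
      push_cast
      rw [abs_mul, abs_pow]
      calc |(-12 : ℝ)| * |(A : ℝ)| ^ 3 ≤ 12 * (V ^ 4) ^ 3 := by
            rw [abs_neg, abs_of_pos (by norm_num : (0 : ℝ) < 12)]
            gcongr
        _ = _ := by ring
    · intro p hp
      obtain ⟨hp, hqp⟩ := Finset.mem_filter.mp hp
      exact ⟨(hS p hp).1, n p, q p, hn p hp, hq p hp, not_le.mp hqp, he p hp⟩
  · intro r hr hrQ
    refine hdiv _ (pow_ne_zero 2 hr.ne') ?_
    have h1 : (r : ℝ) ≤ V ^ 4 := (Nat.cast_le.mpr hrQ).trans hQ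
    push_cast
    calc (r : ℝ) ^ 2 ≤ (V ^ 4) ^ 2 := by gcongr
      _ = 1 * V ^ 8 := by ring
      _ ≤ 12 * V ^ 12 := by
        gcongr
        · norm_num
        · norm_num
  · refine (sum_one_div_le_one_add_log hV4 hQ).trans ?_
    rw [Real.log_pow]
    exact one_add_mul_log_le ha0 (by norm_num) hV
  · intro p hp
    obtain ⟨hp, hqp⟩ := Finset.mem_filter.mp hp
    have h1 : (((q p).toNat : ℕ) : ℤ) = q p := Int.toNat_of_nonneg (hq p hp).le
    have h2 : (((q p).toNat : ℕ) : ℝ) = q p := by exact_mod_cast congrArg (Int.cast (R := ℝ)) h1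
    refine ⟨(hS p hp).1, (q p).toNat, by rw [h2]; exact hPq p hp, ?_, ?_⟩
    · exact Nat.le_floor (by rw [h2]; exact hqp)
    · rw [h1, he p hp]
      exact dvd_mul_left _ _

/-- A curve with a non-torsion point of small canonical height, and a discriminant which is large
and nearly squarefree, has a non-torsion point with small coordinates. -/
lemma exists_small_coordinates {A B : ℤ} {V G D T m : ℝ} (hV : 1 ≤ V) (hT : 1 ≤ T)
    (hA : |(A : ℝ)| ≤ V ^ 4) (hB : |(B : ℝ)| ≤ V ^ 6) (hD : 0 < D)
    (hΔ : D ≤ |(4 * A ^ 3 + 27 * B ^ 2 : ℝ)|)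
    (hG : ∀ g : ℕ, (g : ℤ) ^ 2 ∣ 4 * A ^ 3 + 27 * B ^ 2 → (g : ℝ) ≤ G)
    (hm : Real.exp 1 * T ≤ m) (hmD : 620 * V ^ 12 * G ^ 2 ≤ (m / (Real.exp 1 * T)) ^ 6 * D)
    (hμ : muE A B ≤ ENNReal.ofReal (Real.log T)) :
    ∃ a b : ℤ, ∃ d : ℕ, 0 < d ∧ IsCoprime a d ∧ IsCoprime b d ∧ |(a : ℝ)| ≤ m ^ 2 ∧
      V ^ 2 * d ^ 2 ≤ m ^ 2 ∧ b ^ 2 = a ^ 3 + A * a * d ^ 4 + B * d ^ 6 := by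
  have heT : 0 < Real.exp 1 * T := by positivity
  have hm0 : 0 < m := heT.trans_le hm
  have hlogT := Real.log_nonneg hT
  have hlt : muE A B < ENNReal.ofReal (Real.log T + 1) :=
    hμ.trans_lt ((ENNReal.ofReal_lt_ofReal_iff (by linarith)).mpr (by linarith))
  rw [muE, iInf_lt_iff] at hlt
  obtain ⟨⟨P, hP⟩, hPlt⟩ := hlt
  have hcan := (ENNReal.ofReal_lt_ofReal_iff (by linarith)).mp hPlt
  cases P with
  | zero => exact absurd IsOfFinAddOrder.zero hP
  | some x y h =>
    set K := (m / (Real.exp 1 * T)) ^ 6 with hKdef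
    have hK : 1 ≤ K := one_le_pow₀ ((one_le_div heT).mpr hm)
    have hW : (1 : ℝ) ≤ V ^ 2 := one_le_pow₀ hV
    have hW0 : (0 : ℝ) < V ^ 2 := by linarith
    have h1 := weightedHeight_le_of_canHeight_lt hW hK hP ?_ hcan
    · have h2 : Real.log (weightedHeight (V ^ 2) x) < Real.log (m ^ 2) := by
        refine h1.trans_eq ?_
        rw [hKdef, Real.log_pow, Real.log_div hm0.ne' heT.ne',
          Real.log_mul (Real.exp_pos 1).ne' (by positivity), Real.log_exp, Real.log_pow]
        push_cast
        ring
      have h3 := ((Real.log_lt_log_iff (weightedHeight_pos hW0 x) (by positivity)).mp h2).le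
      rw [weightedHeight, max_le_iff] at h3
      obtain ⟨b, d, hd, hxd, hden, hbd, -, he⟩ := exists_integral_coordinates (Ecurve_equation h)
      lift d to ℕ using hd.le
      refine ⟨x.num, b, d, by exact_mod_cast hd, hxd, hbd, h3.1, ?_, he⟩
      have h4 : (x.den : ℝ) = (d : ℝ) ^ 2 := by exact_mod_cast hden
      rw [← h4]
      exact h3.2
    · intro x y x' y' h h' hy h2
      have h3 := weightedHeight_pow_le (W := V ^ 2) hW0 (hA.trans_eq (by ring))
        (hB.trans_eq (by ring)) hG h h' hy h2
      have h4 := weightedHeight_pos hW0 x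
      have h5 := weightedHeight_pos hW0 x'
      refine le_of_mul_le_mul_left ?_ hD
      calc D * weightedHeight (V ^ 2) x ^ 4
          ≤ |(4 * A ^ 3 + 27 * B ^ 2 : ℝ)| * weightedHeight (V ^ 2) x ^ 4 := by gcongr
        _ ≤ 620 * (V ^ 2) ^ 6 * G ^ 2 * weightedHeight (V ^ 2) x' := h3
        _ = 620 * V ^ 12 * G ^ 2 * weightedHeight (V ^ 2) x' := by ring
        _ ≤ K * D * weightedHeight (V ^ 2) x' := by gcongr
        _ = _ := by ring

lemma abs_le_of_Eheight_le {A B : ℤ} {V : ℝ} (h : (Eheight A B : ℝ) ≤ V ^ 12) :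
    |(A : ℝ)| ≤ V ^ 4 ∧ |(B : ℝ)| ≤ V ^ 6 := by
  rw [Eheight] at h
  push_cast at h
  rw [max_le_iff] at h
  constructor
  · refine le_of_pow_le_pow_left₀ three_ne_zero (by positivity) ?_
    have : 0 ≤ |(A : ℝ)| ^ 3 := by positivity
    calc |(A : ℝ)| ^ 3 ≤ V ^ 12 := by linarith [h.1]
      _ = _ := by ring
  · refine le_of_pow_le_pow_left₀ two_ne_zero (by positivity) ?_
    rw [sq_abs]
    have : 0 ≤ (B : ℝ) ^ 2 := by positivity
    calc (B : ℝ) ^ 2 ≤ V ^ 12 := by linarith [h.2]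
      _ = _ := by ring

/-- The main count, in terms of `V = X ^ (1 / 12)`. -/
lemma exists_card_muE_le {δ : ℝ} (hδ0 : 0 < δ) (hδ1 : δ < 1 / 6) :
    ∃ C : ℝ, 0 < C ∧ ∀ (S : Finset (ℤ × ℤ)) (V T : ℝ), 1 ≤ V → 1 ≤ T →
      (∀ p ∈ S, p ∈ FX (V ^ 12) ∧ muE p.1 p.2 ≤ ENNReal.ofReal (Real.log T)) →
      (S.card : ℝ) ≤ C * (V ^ (24 * δ) * T ^ (2 * δ) *
        (V ^ 9 + V ^ 5 * T + V ^ 3 * T ^ 2 + T ^ 3 / V) + V ^ (10 - 10 * δ)) := by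
  classical
  obtain ⟨C₁, hC₁, hgood⟩ := exists_card_curves_with_small_point_le hδ0
  set η := min (2 * δ) (2 - 10 * δ) with hη
  have hη0 : 0 < η := lt_min (by linarith) (by linarith)
  obtain ⟨C₂, hC₂, hbad⟩ := exists_card_sq_dvd_disc_le hη0
  refine ⟨C₁ * 9 ^ δ * 729 + (2 * C₂ + 15), by positivity, fun S V T hV hT hS => ?_⟩
  have hV0 : 0 < V := by linarith
  have hT0 : 0 < T := by linarith
  have hbox := fun p (hp : p ∈ S) => abs_le_of_Eheight_le (hS p hp).1.2
  set G := V ^ (12 * δ) with hG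
  set L := V ^ (6 - 10 * δ) with hL
  set r := V ^ (22 * δ / 3) with hr
  set m := 9 * T * r with hm
  set Y := V ^ (10 - 10 * δ) with hY
  have hL1 : 1 ≤ L := Real.one_le_rpow hV (by linarith)
  have hr1 : 1 ≤ r := Real.one_le_rpow hV (by positivity)
  have hG0 : 0 < G := by positivity
  have hr6 : V ^ 12 * G ^ 2 = r ^ 6 * L ^ 2 := by
    rw [hG, hr, hL]
    simp only [← Real.rpow_natCast, ← Real.rpow_mul hV0.le, ← Real.rpow_add hV0]
    congr 1
    push_cast
    ring
  set S₁ := S.filter (fun p => p.1 = 0)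
  set S₂ := S.filter (fun p => |(4 * p.1 ^ 3 + 27 * p.2 ^ 2 : ℝ)| ≤ L ^ 2)
  set S₃ := S.filter (fun p => p.1 ≠ 0 ∧ ∃ g : ℕ, G < g ∧ (g : ℤ) ^ 2 ∣ 4 * p.1 ^ 3 + 27 * p.2 ^ 2)
  set S₄ := S.filter (fun p => L ^ 2 ≤ |(4 * p.1 ^ 3 + 27 * p.2 ^ 2 : ℝ)| ∧
    ∀ g : ℕ, (g : ℤ) ^ 2 ∣ 4 * p.1 ^ 3 + 27 * p.2 ^ 2 → (g : ℝ) ≤ G)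
  have hcover : S ⊆ (S₁ ∪ S₂) ∪ (S₃ ∪ S₄) := by
    intro p hp
    simp only [S₁, S₂, S₃, S₄, Finset.mem_union, Finset.mem_filter, hp, true_and]
    by_cases h1 : p.1 = 0
    · exact Or.inl (Or.inl h1)
    rcases le_total |(4 * p.1 ^ 3 + 27 * p.2 ^ 2 : ℝ)| (L ^ 2) with h2 | h2
    · exact Or.inl (Or.inr h2)
    · right
      by_cases h3 : ∃ g : ℕ, G < g ∧ (g : ℤ) ^ 2 ∣ 4 * p.1 ^ 3 + 27 * p.2 ^ 2
      · exact Or.inl ⟨h1, h3⟩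
      · push Not at h3
        exact Or.inr ⟨h2, fun g hg => not_lt.mp fun hlt => h3 g hlt hg⟩
  have hcard : (S.card : ℝ) ≤ (S₁.card + S₂.card) + (S₃.card + S₄.card) := by
    exact_mod_cast (Finset.card_le_card hcover).trans ((Finset.card_union_le _ _).trans
      (add_le_add (Finset.card_union_le _ _) (Finset.card_union_le _ _)))
  have hA : ∀ Q : ℤ × ℤ → Prop, [DecidablePred Q] → ∀ p ∈ S.filter Q, |(p.1 : ℝ)| ≤ V ^ 4 :=
    fun Q _ p hp => (hbox p (Finset.mem_filter.mp hp).1).1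
  have hB : ∀ Q : ℤ × ℤ → Prop, [DecidablePred Q] → ∀ p ∈ S.filter Q, |(p.2 : ℝ)| ≤ V ^ 6 :=
    fun Q _ p hp => (hbox p (Finset.mem_filter.mp hp).1).2
  have h4L : V ^ 4 * L = Y := by
    rw [hY, hL, ← Real.rpow_natCast, ← Real.rpow_add hV0]
    congr 1
    push_cast
    ring
  have hYle : ∀ s : ℝ, s ≤ 10 - 10 * δ → V ^ s ≤ Y := fun s hs =>
    Real.rpow_le_rpow_of_exponent_le hV hs
  have h1 : (S₁.card : ℝ) ≤ 3 * Y := by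
    refine (card_fst_eq_zero_le S₁ hV (fun p hp => (Finset.mem_filter.mp hp).2) (hB _)).trans ?_
    have := hYle (6 : ℕ) (by push_cast; linarith)
    rw [Real.rpow_natCast] at this
    linarith
  have h2 : (S₂.card : ℝ) ≤ 12 * Y := by
    refine (card_small_disc_le S₂ hV (by linarith : 0 ≤ L) (hA _)
      (fun p hp => (Finset.mem_filter.mp hp).2)).trans ?_
    rw [← h4L]
    have : 0 < V ^ 4 := by positivity
    nlinarith
  have h3 : (S₃.card : ℝ) ≤ 2 * C₂ * Y := by
    refine (hbad S₃ V G hV hG0 (hA _) (hB _) (fun p hp => ?_)).trans ?_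
    · obtain ⟨hp, h0, hg⟩ := Finset.mem_filter.mp hp
      exact ⟨h0, (hS p hp).1.1.1, hg⟩
    have e1 : V ^ η * (V ^ 10 / G) ≤ Y := by
      rw [hG, ← Real.rpow_natCast, ← Real.rpow_sub hV0, ← Real.rpow_add hV0]
      refine hYle _ ?_
      have := min_le_left (2 * δ) (2 - 10 * δ)
      push_cast
      linarith
    have e2 : V ^ η * V ^ 8 ≤ Y := by
      rw [← Real.rpow_natCast, ← Real.rpow_add hV0]
      refine hYle _ ?_
      have := min_le_right (2 * δ) (2 - 10 * δ)
      push_cast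
      linarith
    calc C₂ * V ^ η * (V ^ 10 / G + V ^ 8)
        = C₂ * (V ^ η * (V ^ 10 / G) + V ^ η * V ^ 8) := by ring
      _ ≤ C₂ * (Y + Y) := by gcongr
      _ = _ := by ring
  have h4 : (S₄.card : ℝ) ≤ C₁ * 9 ^ δ * 729 * (V ^ (24 * δ) * T ^ (2 * δ) *
      (V ^ 9 + V ^ 5 * T + V ^ 3 * T ^ 2 + T ^ 3 / V)) := by
    have hTm : 9 * T ≤ m := le_mul_of_one_le_right (by positivity) hr1
    have he3 : Real.exp 1 < 3 := Real.exp_one_lt_d9.trans (by norm_num)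
    have heT : 0 < Real.exp 1 * T := by positivity
    refine (hgood S₄ V m hV (by linarith) (hA _) (hB _) (fun p hp => ?_)).trans ?_
    · obtain ⟨hp, hL2, hg⟩ := Finset.mem_filter.mp hp
      obtain ⟨hpA, hpB⟩ := hbox p hp
      refine exists_small_coordinates hV hT hpA hpB (by positivity : 0 < L ^ 2) hL2 hg ?_ ?_
        (hS p hp).2
      · nlinarith
      · have h5 : 3 * r ≤ m / (Real.exp 1 * T) := by
          rw [le_div_iff₀ heT, hm]
          have : 0 < T * r := by positivity
          nlinarith
        calc 620 * V ^ 12 * G ^ 2 = 620 * (r ^ 6 * L ^ 2) := by rw [← hr6]; ring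
          _ ≤ 729 * (r ^ 6 * L ^ 2) := by gcongr; norm_num
          _ = (3 * r) ^ 6 * L ^ 2 := by ring
          _ ≤ _ := by gcongr
    · have hrδ : r ^ δ * r ^ 3 ≤ V ^ (24 * δ) := by
        rw [hr, ← Real.rpow_natCast, ← Real.rpow_mul hV0.le, ← Real.rpow_mul hV0.le,
          ← Real.rpow_add hV0]
        refine Real.rpow_le_rpow_of_exponent_le hV ?_
        push_cast
        nlinarith
      have hTδ : T ^ δ ≤ T ^ (2 * δ) := Real.rpow_le_rpow_of_exponent_le hT (by linarith)
      have hr3 : r ≤ r ^ 3 := le_self_pow₀ hr1 (by norm_num)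
      have hr23 : r ^ 2 ≤ r ^ 3 := pow_le_pow_right₀ hr1 (by norm_num)
      have hr13 : 1 ≤ r ^ 3 := one_le_pow₀ hr1
      have hsum : V ^ 9 + V ^ 5 * m + V ^ 3 * m ^ 2 + m ^ 3 / V ≤
          729 * r ^ 3 * (V ^ 9 + V ^ 5 * T + V ^ 3 * T ^ 2 + T ^ 3 / V) := by
        calc V ^ 9 + V ^ 5 * m + V ^ 3 * m ^ 2 + m ^ 3 / V
            = 1 * 1 * V ^ 9 + 9 * r * (V ^ 5 * T) + 81 * r ^ 2 * (V ^ 3 * T ^ 2) +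
              729 * r ^ 3 * (T ^ 3 / V) := by rw [hm]; ring
          _ ≤ 729 * r ^ 3 * V ^ 9 + 729 * r ^ 3 * (V ^ 5 * T) + 729 * r ^ 3 * (V ^ 3 * T ^ 2) +
              729 * r ^ 3 * (T ^ 3 / V) := by gcongr <;> norm_num
          _ = _ := by ring
      calc C₁ * m ^ δ * (V ^ 9 + V ^ 5 * m + V ^ 3 * m ^ 2 + m ^ 3 / V)
          ≤ C₁ * m ^ δ * (729 * r ^ 3 * (V ^ 9 + V ^ 5 * T + V ^ 3 * T ^ 2 + T ^ 3 / V)) := by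
            gcongr
        _ = C₁ * 9 ^ δ * 729 * ((r ^ δ * r ^ 3) * T ^ δ *
              (V ^ 9 + V ^ 5 * T + V ^ 3 * T ^ 2 + T ^ 3 / V)) := by
            rw [hm, Real.mul_rpow (by positivity) (by positivity),
              Real.mul_rpow (by norm_num) hT0.le]
            ring
        _ ≤ _ := by gcongr
  have hY0 : 0 < Y := by positivity
  have hM0 : 0 < V ^ (24 * δ) * T ^ (2 * δ) *
      (V ^ 9 + V ^ 5 * T + V ^ 3 * T ^ 2 + T ^ 3 / V) := by positivity
  have hc : 0 < C₁ * 9 ^ δ * 729 := by positivity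
  nlinarith

/-- For fixed `δ ∈ (0, 1/6)`, one has
`𝒩(X,T) ≪ (XT)^{2δ} (X^{3/4} + X^{5/12} T + X^{1/4} T² + X^{-1/12} T³) + X^{5/6 - 5δ/6}`. -/
theorem Ncount_bound (δ : ℝ) (hδ : δ ∈ Set.Ioo (0 : ℝ) (1 / 6)) :
    ∃ C : ℝ, 0 < C ∧ ∀ X T : ℝ, 1 ≤ X → 1 ≤ T →
      (Ncount X T : ℝ) ≤ C * ((X * T) ^ (2 * δ) *
        (X ^ ((3 : ℝ) / 4) + X ^ ((5 : ℝ) / 12) * T + X ^ ((1 : ℝ) / 4) * T ^ 2 +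
          X ^ (-(1 : ℝ) / 12) * T ^ 3) + X ^ (5 / 6 - 5 * δ / 6)) := by
  obtain ⟨C, hC, hmain⟩ := exists_card_muE_le hδ.1 hδ.2
  refine ⟨C, hC, fun X T hX hT => ?_⟩
  have hX0 : 0 < X := by linarith
  set V := X ^ ((1 : ℝ) / 12) with hV
  have hV1 : 1 ≤ V := Real.one_le_rpow hX (by norm_num)
  have hV0 : 0 < V := by linarith
  have hpow : ∀ s : ℝ, X ^ s = V ^ (12 * s) := by
    intro s
    rw [hV, ← Real.rpow_mul hX0.le]
    congr 1
    ring
  have hX12 : X = V ^ 12 := by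
    have := hpow 1
    rw [Real.rpow_one] at this
    rw [this, ← Real.rpow_natCast]
    norm_num
  have hfin : {p : ℤ × ℤ | p ∈ FX X ∧ muE p.1 p.2 ≤ ENNReal.ofReal (Real.log T)}.Finite := by
    refine (intBall (V ^ 4) ×ˢ intBall (V ^ 6)).finite_toSet.subset fun p hp => ?_
    have := abs_le_of_Eheight_le (hp.1.2.trans_eq hX12)
    exact Finset.mem_coe.mpr (Finset.mem_product.mpr
      ⟨mem_intBall.mpr this.1, mem_intBall.mpr this.2⟩)
  have hN : Ncount X T = hfin.toFinset.card := by
    rw [← Set.ncard_eq_toFinset_card _ hfin]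
    rfl
  rw [hN]
  refine (hmain hfin.toFinset V T hV1 hT (fun p hp => ?_)).trans_eq ?_
  · rw [← hX12]
    exact hfin.mem_toFinset.mp hp
  · have e1 : X ^ ((3 : ℝ) / 4) = V ^ 9 := by
      rw [hpow, ← Real.rpow_natCast]; norm_num
    have e2 : X ^ ((5 : ℝ) / 12) = V ^ 5 := by
      rw [hpow, ← Real.rpow_natCast]; norm_num
    have e3 : X ^ ((1 : ℝ) / 4) = V ^ 3 := by
      rw [hpow, ← Real.rpow_natCast]; norm_num
    have e4 : X ^ (-(1 : ℝ) / 12) = V⁻¹ := by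
      rw [hpow, ← Real.rpow_neg_one]; norm_num
    have e5 : X ^ (5 / 6 - 5 * δ / 6) = V ^ (10 - 10 * δ) := by
      rw [hpow]; congr 1; ring
    have e6 : (X * T) ^ (2 * δ) = V ^ (24 * δ) * T ^ (2 * δ) := by
      rw [Real.mul_rpow hX0.le (by linarith), hpow]
      congr 2
      ring
    rw [e1, e2, e3, e4, e5, e6]
    ring
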